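/- arXiv:2208.13637 — 6 statements merged into one kernel-verified Lean document; each statement's English description precedes it below -/
import Mathlib

section
/- Let G be a generalized (m,n)-ladder graph. Then G is planar if and only if for each edge e ∈ [G₁,G₂], at least one of the four sets L↑(e) ∩ R↓(e), L↑(e) ∩ R↑(e), L↓(e) ∩ R↑(e), L↓(e) ∩ R↓(e) is empty. -/
open SimpleGraph

/-- `G` contains a subdivision of `H`: there is an injection `f` of the vertices of `H`
into the vertices of `G` and, for each edge of `H`, a path in `G` between the images of its
endpoints, such that the paths pass through no branch vertices other than their own endpoints
and paths corresponding to distinct edges are internally disjoint. -/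
def ContainsSubdivision {V W : Type*} (G : SimpleGraph V) (H : SimpleGraph W) : Prop :=
  ∃ f : W → V, Function.Injective f ∧
    ∃ p : ∀ ⦃a b : W⦄, H.Adj a b → G.Walk (f a) (f b),
      (∀ ⦃a b : W⦄ (h : H.Adj a b), (p h).IsPath) ∧
      (∀ ⦃a b : W⦄ (h : H.Adj a b) (w : W), f w ∈ (p h).support → w = a ∨ w = b) ∧
      (∀ ⦃a b a' b' : W⦄ (h : H.Adj a b) (h' : H.Adj a' b'), s(a, b) ≠ s(a', b') →
        ∀ v, v ∈ (p h).support → v ∈ (p h').support →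
          (v = f a ∨ v = f b) ∧ (v = f a' ∨ v = f b'))

/-- A graph is planar iff it contains no subdivision of `K₅` or `K₃,₃` (Kuratowski). -/
def IsPlanar {V : Type*} (G : SimpleGraph V) : Prop :=
  ¬ ContainsSubdivision G (completeGraph (Fin 5)) ∧
  ¬ ContainsSubdivision G (completeBipartiteGraph (Fin 3) (Fin 3))

/-- A graph is outerplanar iff it contains no subdivision of `K₄` or `K₃,₂`
(Chartrand–Harary). -/
def IsOuterplanar {V : Type*} (G : SimpleGraph V) : Prop :=
  ¬ ContainsSubdivision G (completeGraph (Fin 4)) ∧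
  ¬ ContainsSubdivision G (completeBipartiteGraph (Fin 3) (Fin 2))

/-- The base relation of a generalized (m,n)-ladder graph: consecutive vertices on each of the
two paths are adjacent, and `u i` is adjacent to `v j` exactly when `(i, j)` is a cross edge. -/
def ladderRel (m n : ℕ) (cross : Finset (Fin m × Fin n)) :
    Fin m ⊕ Fin n → Fin m ⊕ Fin n → Prop
  | Sum.inl i, Sum.inl j => (i : ℕ) + 1 = (j : ℕ)
  | Sum.inr i, Sum.inr j => (i : ℕ) + 1 = (j : ℕ)
  | Sum.inl i, Sum.inr j => (i, j) ∈ cross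
  | Sum.inr _, Sum.inl _ => False

/-- The generalized (m,n)-ladder graph determined by the set `cross` of cross edges
`[G₁, G₂]`.  Vertices `Sum.inl i` are the vertices `u_{i+1}` of the path `G₁` and
vertices `Sum.inr j` are the vertices `v_{j+1}` of the path `G₂`. -/
def ladderGraph (m n : ℕ) (cross : Finset (Fin m × Fin n)) :
    SimpleGraph (Fin m ⊕ Fin n) :=
  SimpleGraph.fromRel (ladderRel m n cross)

/-- `L↑(e)`: the cross edges `e'` with `l(e) < l(e')`. -/
def Lup {m n : ℕ} (cross : Finset (Fin m × Fin n)) (e : Fin m × Fin n) :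
    Finset (Fin m × Fin n) := cross.filter fun e' => e.1 < e'.1

/-- `L↓(e)`: the cross edges `e'` with `l(e') < l(e)`. -/
def Ldown {m n : ℕ} (cross : Finset (Fin m × Fin n)) (e : Fin m × Fin n) :
    Finset (Fin m × Fin n) := cross.filter fun e' => e'.1 < e.1

/-- `R↑(e)`: the cross edges `e'` with `r(e) < r(e')`. -/
def Rup {m n : ℕ} (cross : Finset (Fin m × Fin n)) (e : Fin m × Fin n) :
    Finset (Fin m × Fin n) := cross.filter fun e' => e.2 < e'.2

/-- `R↓(e)`: the cross edges `e'` with `r(e') < r(e)`. -/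
def Rdown {m n : ℕ} (cross : Finset (Fin m × Fin n)) (e : Fin m × Fin n) :
    Finset (Fin m × Fin n) := cross.filter fun e' => e'.2 < e.2

section ParityObstruction

variable {V : Type*} {G : SimpleGraph V}

/-- The sum of `φ` over the darts of a walk. -/
def walkSum (φ : V → V → V → ZMod 2) (x : V) : ∀ {a b : V}, G.Walk a b → ZMod 2
  | _, _, .nil => 0
  | _, _, .cons (u := a) (v := b) _ p => φ a b x + walkSum φ x p

/-- If every two independent edges cross evenly, with crossings counted modulo two by the
endpoint form `B` corrected by `φ`, then so do every two disjoint walks. -/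
theorem even_crossing_of_disjoint {B : V → V → ZMod 2} {φ : V → V → V → ZMod 2}
    (hG : ∀ a b c d, G.Adj a b → G.Adj c d → a ≠ c → a ≠ d → b ≠ c → b ≠ d →
      B a c + B a d + B b c + B b d + φ a b c + φ a b d + φ c d a + φ c d b = 0)
    {a b c d : V} (p : G.Walk a b) (q : G.Walk c d)
    (hpq : ∀ v, v ∈ p.support → v ∉ q.support) :
    B a c + B a d + B b c + B b d + walkSum φ c p + walkSum φ d p
      + walkSum φ a q + walkSum φ b q = 0 := by
  have two : (2 : ZMod 2) = 0 := rfl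
  induction p with
  | nil =>
    simp only [walkSum]
    linear_combination (B _ c + B _ d + walkSum φ _ q) * two
  | @cons a a' b hadj p ih =>
    have ih := ih fun v hv => hpq v (by simp [hv])
    have key : ∀ {c d : V} (q : G.Walk c d), a ∉ q.support → a' ∉ q.support →
        B a c + B a d + B a' c + B a' d + φ a a' c + φ a a' d
          + walkSum φ a q + walkSum φ a' q = 0 := by
      intro c d q ha ha'
      induction q with
      | nil =>
        simp only [walkSum]
        linear_combination (B a _ + B a' _ + φ a a' _) * two
      | @cons c c' d hc q ihq =>
        simp only [Walk.support_cons, List.mem_cons, not_or] at ha ha'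
        have h1 := ihq ha.2 ha'.2
        have h2 := hG a a' c c' hadj hc ha.1 (fun h => ha.2 (h ▸ q.start_mem_support))
          ha'.1 (fun h => ha'.2 (h ▸ q.start_mem_support))
        simp only [walkSum]
        linear_combination h1 + h2 - (B a c' + B a' c' + φ a a' c') * two
    have h := key q (hpq a (by simp)) (hpq a' (by simp))
    simp only [walkSum]
    linear_combination ih + h - (B a' c + B a' d + walkSum φ a' q) * two

private theorem k33_parity (B : V → V → ZMod 2) (hB : ∀ x y, x ≠ y → B x y + B y x = 1)
    (x y : Fin 3 → V) (hy : ∀ i j, i ≠ j → y i ≠ y j) (Φ : Fin 3 → Fin 3 → V → ZMod 2)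
    (h : ∀ i k j l, i ≠ j → k ≠ l →
      B (x i) (x j) + B (x i) (y l) + B (y k) (x j) + B (y k) (y l)
        + Φ i k (x j) + Φ i k (y l) + Φ j l (x i) + Φ j l (y k) = 0) : False := by
  have two : (2 : ZMod 2) = 0 := rfl
  refine one_ne_zero (α := ZMod 2) ?_
  linear_combination
    h 0 0 1 1 (by decide) (by decide) + h 0 0 1 2 (by decide) (by decide) + h 0 1 1 0 (by
      decide) (by decide) + h 0 1 1 2 (by decide) (by decide) + h 0 2 1 0 (by decide) (by
      decide) + h 0 2 1 1 (by decide) (by decide) + h 0 0 2 1 (by decide) (by decide) + h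
      0 0 2 2 (by decide) (by decide) + h 0 1 2 0 (by decide) (by decide) + h 0 1 2 2 (by
      decide) (by decide) + h 0 2 2 0 (by decide) (by decide) + h 0 2 2 1 (by decide) (by
      decide) + h 1 0 2 1 (by decide) (by decide) + h 1 0 2 2 (by decide) (by decide) + h
      1 1 2 0 (by decide) (by decide) + h 1 1 2 2 (by decide) (by decide) + h 1 2 2 0 (by
      decide) (by decide) + h 1 2 2 1 (by decide) (by decide) - hB _ _ (hy 0 1 (by
      decide)) - hB _ _ (hy 0 2 (by decide)) - hB _ _ (hy 1 2 (by decide)) - (1 + 3 * B (x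
      0) (x 1) + 2 * B (x 0) (y 1) + B (y 0) (x 1) + B (y 0) (y 1) + Φ 0 0 (x 1) + Φ 0 0
      (y 1) + Φ 1 1 (x 0) + Φ 1 1 (y 0) + 2 * B (x 0) (y 2) + B (y 0) (y 2) + Φ 0 0 (y 2)
      + Φ 1 2 (x 0) + Φ 1 2 (y 0) + 2 * B (x 0) (y 0) + B (y 1) (x 1) + B (y 1) (y 0) + Φ
      0 1 (x 1) + Φ 0 1 (y 0) + Φ 1 0 (x 0) + Φ 1 0 (y 1) + B (y 1) (y 2) + Φ 0 1 (y 2) +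
      Φ 1 2 (y 1) + B (y 2) (x 1) + B (y 2) (y 0) + Φ 0 2 (x 1) + Φ 0 2 (y 0) + Φ 1 0 (y
      2) + B (y 2) (y 1) + Φ 0 2 (y 1) + Φ 1 1 (y 2) + 3 * B (x 0) (x 2) + 2 * B (y 0) (x
      2) + Φ 0 0 (x 2) + Φ 2 1 (x 0) + Φ 2 1 (y 0) + Φ 2 2 (x 0) + Φ 2 2 (y 0) + 2 * B (y
      1) (x 2) + Φ 0 1 (x 2) + Φ 2 0 (x 0) + Φ 2 0 (y 1) + Φ 2 2 (y 1) + 2 * B (y 2) (x 2)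
      + Φ 0 2 (x 2) + Φ 2 0 (y 2) + Φ 2 1 (y 2) + 3 * B (x 1) (x 2) + B (x 1) (y 1) + Φ 1
      0 (x 2) + Φ 2 1 (x 1) + B (x 1) (y 2) + Φ 2 2 (x 1) + B (x 1) (y 0) + Φ 1 1 (x 2) +
      Φ 2 0 (x 1) + Φ 1 2 (x 2)) * two

private theorem k5_parity (B : V → V → ZMod 2) (hB : ∀ x y, x ≠ y → B x y + B y x = 1)
    (x : Fin 5 → V) (hx : ∀ i j, i ≠ j → x i ≠ x j) (Φ : Fin 5 → Fin 5 → V → ZMod 2)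
    (h : ∀ i j k l, i ≠ j → k ≠ l → i ≠ k → i ≠ l → j ≠ k → j ≠ l →
      B (x i) (x k) + B (x i) (x l) + B (x j) (x k) + B (x j) (x l)
        + Φ i j (x k) + Φ i j (x l) + Φ k l (x i) + Φ k l (x j) = 0) : False := by
  have two : (2 : ZMod 2) = 0 := rfl
  refine one_ne_zero (α := ZMod 2) ?_
  linear_combination
    h 0 1 2 3 (by decide) (by decide) (by decide) (by decide) (by decide) (by decide) + h
      0 1 2 4 (by decide) (by decide) (by decide) (by decide) (by decide) (by decide) + h
      0 1 3 4 (by decide) (by decide) (by decide) (by decide) (by decide) (by decide) + h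
      0 2 1 3 (by decide) (by decide) (by decide) (by decide) (by decide) (by decide) + h
      0 2 1 4 (by decide) (by decide) (by decide) (by decide) (by decide) (by decide) + h
      0 2 3 4 (by decide) (by decide) (by decide) (by decide) (by decide) (by decide) + h
      0 3 1 2 (by decide) (by decide) (by decide) (by decide) (by decide) (by decide) + h
      0 3 1 4 (by decide) (by decide) (by decide) (by decide) (by decide) (by decide) + h
      0 3 2 4 (by decide) (by decide) (by decide) (by decide) (by decide) (by decide) + h
      0 4 1 2 (by decide) (by decide) (by decide) (by decide) (by decide) (by decide) + h
      0 4 1 3 (by decide) (by decide) (by decide) (by decide) (by decide) (by decide) + h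
      0 4 2 3 (by decide) (by decide) (by decide) (by decide) (by decide) (by decide) + h
      1 2 3 4 (by decide) (by decide) (by decide) (by decide) (by decide) (by decide) + h
      1 3 2 4 (by decide) (by decide) (by decide) (by decide) (by decide) (by decide) + h
      1 4 2 3 (by decide) (by decide) (by decide) (by decide) (by decide) (by decide) - hB
      _ _ (hx 2 3 (by decide)) - hB _ _ (hx 2 4 (by decide)) - hB _ _ (hx 3 4 (by decide))
      - (1 + 3 * B (x 0) (x 2) + 3 * B (x 0) (x 3) + 2 * B (x 1) (x 2) + 2 * B (x 1) (x 3)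
      + Φ 0 1 (x 2) + Φ 0 1 (x 3) + Φ 2 3 (x 0) + Φ 2 3 (x 1) + 3 * B (x 0) (x 4) + 2 * B
      (x 1) (x 4) + Φ 0 1 (x 4) + Φ 2 4 (x 0) + Φ 2 4 (x 1) + Φ 3 4 (x 0) + Φ 3 4 (x 1) +
      3 * B (x 0) (x 1) + B (x 2) (x 1) + B (x 2) (x 3) + Φ 0 2 (x 1) + Φ 0 2 (x 3) + Φ 1
      3 (x 0) + Φ 1 3 (x 2) + B (x 2) (x 4) + Φ 0 2 (x 4) + Φ 1 4 (x 0) + Φ 1 4 (x 2) + Φ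
      3 4 (x 2) + B (x 3) (x 1) + B (x 3) (x 2) + Φ 0 3 (x 1) + Φ 0 3 (x 2) + Φ 1 2 (x 0)
      + Φ 1 2 (x 3) + B (x 3) (x 4) + Φ 0 3 (x 4) + Φ 1 4 (x 3) + Φ 2 4 (x 3) + B (x 4) (x
      1) + B (x 4) (x 2) + Φ 0 4 (x 1) + Φ 0 4 (x 2) + Φ 1 2 (x 4) + B (x 4) (x 3) + Φ 0 4
      (x 3) + Φ 1 3 (x 4) + Φ 2 3 (x 4)) * two

/-- A graph whose independent edges all cross evenly is planar. -/
theorem isPlanar_of_even_crossing (B : V → V → ZMod 2) (φ : V → V → V → ZMod 2)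
    (hB : ∀ x y, x ≠ y → B x y + B y x = 1)
    (hG : ∀ a b c d, G.Adj a b → G.Adj c d → a ≠ c → a ≠ d → b ≠ c → b ≠ d →
      B a c + B a d + B b c + B b d + φ a b c + φ a b d + φ c d a + φ c d b = 0) :
    IsPlanar G := by
  constructor
  · rintro ⟨f, hf, p, -, -, hp⟩
    refine k5_parity B hB f (fun i j hij => hf.ne hij)
      (fun i j v => if h : i ≠ j then walkSum φ v (p (a := i) (b := j) h) else 0) ?_
    intro i j k l hij hkl hik hil hjk hjl
    simp only [hij, hkl, ne_eq, not_false_eq_true, dite_true]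
    refine even_crossing_of_disjoint hG (p (a := i) (b := j) hij) (p (a := k) (b := l) hkl) ?_
    intro v hv hv'
    have := hp (a := i) (b := j) (a' := k) (b' := l) hij hkl (by simp; tauto) v hv hv'
    rcases this with ⟨rfl | rfl, h | h⟩ <;> have := hf h <;> tauto
  · rintro ⟨f, hf, p, -, -, hp⟩
    have adj (i k : Fin 3) :
        (completeBipartiteGraph (Fin 3) (Fin 3)).Adj (Sum.inl i) (Sum.inr k) := by simp
    refine k33_parity B hB (fun i => f (Sum.inl i)) (fun i => f (Sum.inr i))
      (fun i j hij => hf.ne (by simpa using hij)) (fun i j v => walkSum φ v (p (adj i j))) ?_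
    intro i k j l hij hkl
    refine even_crossing_of_disjoint hG (p (adj i k)) (p (adj j l)) ?_
    intro v hv hv'
    have := hp (adj i k) (adj j l) (by simp [hij]) v hv hv'
    rcases this with ⟨rfl | rfl, h | h⟩ <;> have := hf h <;> simp_all

/-- A `K₃,₃` subdivision arises from nine walks that only meet in the required endpoints. -/
theorem containsSubdivision_k33_of_walks (A B : Fin 3 → V) (S : Fin 3 → Fin 3 → Set V)
    (hw : ∀ i k, ∃ w : G.Walk (A i) (B k), ∀ v ∈ w.support, v ∈ S i k)
    (hS : ∀ i k j l v, v ∈ S i k → v ∈ S j l →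
      (i = j ∧ k = l) ∨ (i = j ∧ v = A i) ∨ (k = l ∧ v = B k)) :
    ContainsSubdivision G (completeBipartiteGraph (Fin 3) (Fin 3)) := by
  classical
  choose w hw using hw
  have hA i k : A i ∈ S i k := hw i k _ (w i k).start_mem_support
  have hB i k : B k ∈ S i k := hw i k _ (w i k).end_mem_support
  have other (k : Fin 3) : ∃ l, l ≠ k := exists_ne k
  have hAS i j k (h : A j ∈ S i k) : j = i := by
    by_contra hne
    obtain ⟨l, hl⟩ := other k
    have := hS i k j l _ h (hA j l)
    grind
  have hBS i k l (h : B l ∈ S i k) : l = k := by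
    by_contra hne
    obtain ⟨j, hj⟩ := other i
    have := hS i k j l _ h (hB j l)
    grind
  have hAB i k : A i ≠ B k := by
    intro h
    obtain ⟨l, hl⟩ := other k
    exact hl.symm (hBS i l k (h ▸ hA i l))
  have hw' i k v (hv : v ∈ (w i k).bypass.support) : v ∈ S i k :=
    hw i k v ((w i k).support_bypass_subset_support hv)
  refine ⟨Sum.elim A B, ?_, fun a b h => match a, b, h with
    | .inl i, .inr k, _ => (w i k).bypass
    | .inr k, .inl i, _ => (w i k).bypass.reverse
    | .inl _, .inl _, h => absurd h (by simp)
    | .inr _, .inr _, h => absurd h (by simp), ?_, ?_, ?_⟩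
  · rintro (i | i) (j | j) h
    · exact congrArg _ (hAS j i 0 (by simp only [Sum.elim_inl] at h; exact h ▸ hA j 0))
    · exact absurd h (hAB i j)
    · exact absurd h.symm (hAB j i)
    · exact congrArg _ (hBS 0 j i (by simp only [Sum.elim_inr] at h; exact h ▸ hB 0 j))
  · rintro (i | i) (j | j) h
    · simp at h
    · exact (w i j).bypass_isPath
    · exact (w j i).bypass_isPath.reverse
    · simp at h
  · rintro (i | i) (j | j) h (l | l) hl
    all_goals first
      | (simp at h; done)
      | skip
    · exact Or.inl (congrArg _ (hAS _ _ _ (hw' _ _ _ hl)))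
    · exact Or.inr (congrArg _ (hBS _ _ _ (hw' _ _ _ hl)))
    · exact Or.inr (congrArg _ (hAS _ _ _ (hw' _ _ _ (by simpa using hl))))
    · exact Or.inl (congrArg _ (hBS _ _ _ (hw' _ _ _ (by simpa using hl))))
  · rintro (i | i) (j | j) (k | k) (l | l) h h' hne v hv hv'
    all_goals first
      | (simp at h; done)
      | (simp at h'; done)
      | skip
    · have := hS _ _ _ _ v (hw' _ _ _ hv) (hw' _ _ _ hv')
      simp only [Sum.elim_inl, Sum.elim_inr]
      simp at hne
      grind
    · have := hS _ _ _ _ v (hw' _ _ _ hv) (hw' _ _ _ (by simpa using hv'))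
      simp only [Sum.elim_inl, Sum.elim_inr]
      simp at hne
      grind
    · have := hS _ _ _ _ v (hw' _ _ _ (by simpa using hv)) (hw' _ _ _ hv')
      simp only [Sum.elim_inl, Sum.elim_inr]
      simp at hne
      grind
    · have := hS _ _ _ _ v (hw' _ _ _ (by simpa using hv)) (hw' _ _ _ (by simpa using hv'))
      simp only [Sum.elim_inl, Sum.elim_inr]
      simp at hne
      grind

end ParityObstruction

section Ladder

variable {m n : ℕ} {cross : Finset (Fin m × Fin n)}

theorem ladderGraph_adj_inl_inl {i j : Fin m} :
    (ladderGraph m n cross).Adj (.inl i) (.inl j) ↔ (i : ℕ) + 1 = j ∨ (j : ℕ) + 1 = i := by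
  simp only [ladderGraph, fromRel_adj, ladderRel, ne_eq, Sum.inl.injEq, Fin.ext_iff]
  omega

theorem ladderGraph_adj_inr_inr {i j : Fin n} :
    (ladderGraph m n cross).Adj (.inr i) (.inr j) ↔ (i : ℕ) + 1 = j ∨ (j : ℕ) + 1 = i := by
  simp only [ladderGraph, fromRel_adj, ladderRel, ne_eq, Sum.inr.injEq, Fin.ext_iff]
  omega

theorem ladderGraph_adj_inl_inr {i : Fin m} {j : Fin n} :
    (ladderGraph m n cross).Adj (.inl i) (.inr j) ↔ (i, j) ∈ cross := by
  simp [ladderGraph, ladderRel]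

theorem ladderGraph_adj_inr_inl {i : Fin m} {j : Fin n} :
    (ladderGraph m n cross).Adj (.inr j) (.inl i) ↔ (i, j) ∈ cross := by
  simp [ladderGraph, ladderRel]

/-- The vertices `u_t` with `t ∈ [p, q]` together with the vertices `v_t` with `t ∈ [r, s]`. -/
def ladderBox (p q : Fin m) (r s : Fin n) : Set (Fin m ⊕ Fin n) :=
  {z | Sum.elim (fun t => p ≤ t ∧ t ≤ q) (fun t => r ≤ t ∧ t ≤ s) z}

theorem exists_walk_inl {S : Set (Fin m ⊕ Fin n)} {p q : Fin m} (hpq : p ≤ q)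
    (hS : ∀ t, p ≤ t → t ≤ q → Sum.inl t ∈ S) :
    ∃ w : (ladderGraph m n cross).Walk (.inl p) (.inl q), ∀ z ∈ w.support, z ∈ S := by
  obtain ⟨p, hp⟩ := p
  obtain ⟨q, hq⟩ := q
  induction q with
  | zero =>
    obtain rfl : p = 0 := by simpa using hpq
    exact ⟨.nil, by simpa using hS _ le_rfl le_rfl⟩
  | succ q ih =>
    rcases eq_or_lt_of_le hpq with h | h
    · cases h
      exact ⟨.nil, by simpa using hS _ le_rfl le_rfl⟩
    · simp only [Fin.mk_lt_mk] at h
      obtain ⟨w, hw⟩ := ih (by omega) (by simp; omega) fun t h1 h2 =>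
        hS t h1 (h2.trans (by simp))
      refine ⟨w.concat (ladderGraph_adj_inl_inl.2 (by simp)), ?_⟩
      intro z hz
      simp only [Walk.support_concat, List.mem_append, List.mem_singleton] at hz
      rcases hz with hz | rfl
      exacts [hw z hz, hS _ hpq le_rfl]

theorem exists_walk_inr {S : Set (Fin m ⊕ Fin n)} {p q : Fin n} (hpq : p ≤ q)
    (hS : ∀ t, p ≤ t → t ≤ q → Sum.inr t ∈ S) :
    ∃ w : (ladderGraph m n cross).Walk (.inr p) (.inr q), ∀ z ∈ w.support, z ∈ S := by
  obtain ⟨p, hp⟩ := p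
  obtain ⟨q, hq⟩ := q
  induction q with
  | zero =>
    obtain rfl : p = 0 := by simpa using hpq
    exact ⟨.nil, by simpa using hS _ le_rfl le_rfl⟩
  | succ q ih =>
    rcases eq_or_lt_of_le hpq with h | h
    · cases h
      exact ⟨.nil, by simpa using hS _ le_rfl le_rfl⟩
    · simp only [Fin.mk_lt_mk] at h
      obtain ⟨w, hw⟩ := ih (by omega) (by simp; omega) fun t h1 h2 =>
        hS t h1 (h2.trans (by simp))
      refine ⟨w.concat (ladderGraph_adj_inr_inr.2 (by simp)), ?_⟩
      intro z hz
      simp only [Walk.support_concat, List.mem_append, List.mem_singleton] at hz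
      rcases hz with hz | rfl
      exacts [hw z hz, hS _ hpq le_rfl]

theorem exists_walk_reverse {V : Type*} {G : SimpleGraph V} {S : Set V} {a b : V}
    (h : ∃ w : G.Walk a b, ∀ z ∈ w.support, z ∈ S) :
    ∃ w : G.Walk b a, ∀ z ∈ w.support, z ∈ S := by
  obtain ⟨w, hw⟩ := h
  exact ⟨w.reverse, by simpa using hw⟩

/-- Two vertices on different sides are joined inside a box containing a cross edge. -/
theorem exists_walk_inr_inl {p q x c : Fin m} {r s y d : Fin n} (hc : (c, d) ∈ cross)
    (hx : p ≤ x ∧ x ≤ q) (hy : r ≤ y ∧ y ≤ s) (hc1 : p ≤ c ∧ c ≤ q) (hd : r ≤ d ∧ d ≤ s) :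
    ∃ w : (ladderGraph m n cross).Walk (.inr y) (.inl x),
      ∀ z ∈ w.support, z ∈ ladderBox p q r s := by
  have h1 : ∃ w : (ladderGraph m n cross).Walk (.inr y) (.inr d),
      ∀ z ∈ w.support, z ∈ ladderBox p q r s := by
    rcases le_total y d with h | h
    · exact exists_walk_inr h fun t h1 h2 => ⟨hy.1.trans h1, h2.trans hd.2⟩
    · exact exists_walk_reverse
        (exists_walk_inr h fun t h1 h2 => ⟨hd.1.trans h1, h2.trans hy.2⟩)
  have h2 : ∃ w : (ladderGraph m n cross).Walk (.inl c) (.inl x),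
      ∀ z ∈ w.support, z ∈ ladderBox p q r s := by
    rcases le_total c x with h | h
    · exact exists_walk_inl h fun t h1 h2 => ⟨hc1.1.trans h1, h2.trans hx.2⟩
    · exact exists_walk_reverse
        (exists_walk_inl h fun t h1 h2 => ⟨hx.1.trans h1, h2.trans hc1.2⟩)
  obtain ⟨w1, h1⟩ := h1
  obtain ⟨w2, h2⟩ := h2
  refine ⟨w1.append (.cons (ladderGraph_adj_inr_inl.2 hc) w2), fun z hz => ?_⟩
  rw [Walk.mem_support_append_iff, Walk.support_cons, List.mem_cons] at hz
  rcases hz with hz | rfl | hz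
  exacts [h1 z hz, hd, h2 z hz]

set_option maxHeartbeats 4000000 in
/-- A cross edge with cross edges in all four quadrants yields a `K₃,₃` subdivision. -/
theorem containsSubdivision_k33_of_quadrants {i a₁ b₁ c₁ d₁ : Fin m} {j a₂ b₂ c₂ d₂ : Fin n}
    (he : (i, j) ∈ cross) (ha : (a₁, a₂) ∈ cross) (hb : (b₁, b₂) ∈ cross)
    (hc : (c₁, c₂) ∈ cross) (hd : (d₁, d₂) ∈ cross)
    (ha₁ : i < a₁) (ha₂ : a₂ < j) (hb₁ : i < b₁) (hb₂ : j < b₂)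
    (hc₁ : c₁ < i) (hc₂ : j < c₂) (hd₁ : d₁ < i) (hd₂ : d₂ < j) :
    ContainsSubdivision (ladderGraph m n cross) (completeBipartiteGraph (Fin 3) (Fin 3)) := by
  obtain ⟨x, hxa, hxb, hx⟩ : ∃ x, x ≤ a₁ ∧ x ≤ b₁ ∧ (x = a₁ ∨ x = b₁) :=
    ⟨min a₁ b₁, min_le_left _ _, min_le_right _ _, min_choice _ _⟩
  obtain ⟨x', hxc, hxd, hx'⟩ : ∃ x, c₁ ≤ x ∧ d₁ ≤ x ∧ (x = c₁ ∨ x = d₁) :=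
    ⟨max c₁ d₁, le_max_left _ _, le_max_right _ _, max_choice _ _⟩
  obtain ⟨y, hyb, hyc, hy⟩ : ∃ y, y ≤ b₂ ∧ y ≤ c₂ ∧ (y = b₂ ∨ y = c₂) :=
    ⟨min b₂ c₂, min_le_left _ _, min_le_right _ _, min_choice _ _⟩
  obtain ⟨y', hya, hyd, hy'⟩ : ∃ y, a₂ ≤ y ∧ d₂ ≤ y ∧ (y = a₂ ∨ y = d₂) :=
    ⟨max a₂ d₂, le_max_left _ _, le_max_right _ _, max_choice _ _⟩
  have hix : i < x := by grind
  have hix' : x' < i := by grind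
  have hjy : j < y := by grind
  have hjy' : y' < j := by grind
  refine containsSubdivision_k33_of_walks
    ![.inl i, .inr y, .inr y'] ![.inr j, .inl x, .inl x']
    ![![ladderBox i i j j, ladderBox i x j y', ladderBox x' i j y'],
      ![ladderBox i x' j y, ladderBox x b₁ y b₂, ladderBox c₁ x' y c₂],
      ![ladderBox i x' y' j, ladderBox x a₁ a₂ y', ladderBox d₁ x' d₂ y']] ?_ ?_
  · intro k l
    fin_cases k <;> fin_cases l
    · exact exists_walk_reverse (exists_walk_inr_inl he ⟨le_rfl, le_rfl⟩ ⟨le_rfl, le_rfl⟩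
        ⟨le_rfl, le_rfl⟩ ⟨le_rfl, le_rfl⟩)
    · exact exists_walk_inl hix.le fun t h1 h2 => ⟨h1, h2⟩
    · exact exists_walk_reverse (exists_walk_inl hix'.le fun t h1 h2 => ⟨h1, h2⟩)
    · exact exists_walk_reverse (exists_walk_inr hjy.le fun t h1 h2 => ⟨h1, h2⟩)
    · exact exists_walk_inr_inl hb ⟨le_rfl, hxb⟩ ⟨le_rfl, hyb⟩ ⟨hxb, le_rfl⟩ ⟨hyb, le_rfl⟩
    · exact exists_walk_inr_inl hc ⟨hxc, le_rfl⟩ ⟨le_rfl, hyc⟩ ⟨le_rfl, hxc⟩ ⟨hyc, le_rfl⟩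
    · exact exists_walk_inr hjy'.le fun t h1 h2 => ⟨h1, h2⟩
    · exact exists_walk_inr_inl ha ⟨le_rfl, hxa⟩ ⟨hya, le_rfl⟩ ⟨hxa, le_rfl⟩ ⟨le_rfl, hya⟩
    · exact exists_walk_inr_inl hd ⟨hxd, le_rfl⟩ ⟨hyd, le_rfl⟩ ⟨le_rfl, hxd⟩ ⟨le_rfl, hyd⟩
  · intro k l k' l' v
    rcases v with t | t <;> fin_cases k <;> fin_cases l <;> fin_cases k' <;> fin_cases l' <;>
      simp [ladderBox] <;> omega

/-- Crossing form on the vertices of a ladder, placed on a line in the order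
`u₁, …, u_m, v_n, …, v₁`. -/
def ladderForm : Fin m ⊕ Fin n → Fin m ⊕ Fin n → ZMod 2
  | .inl i, .inl i' => if i < i' then 1 else 0
  | .inl _, .inr _ => 1
  | .inr _, .inl _ => 0
  | .inr j, .inr j' => if j' < j then 1 else 0

/-- Correction of `ladderForm` for a cross edge whose two ends leave the line on the lower side
according to `α` and `β`. -/
def crossShift (α β : Fin m × Fin n → Bool) (e : Fin m × Fin n) : Fin m ⊕ Fin n → ZMod 2
  | .inl i => if α e ∧ e.1 < i then 1 else 0
  | .inr j => (if β e ∧ j < e.2 then 1 else 0) + if α e ∧ β e then 1 else 0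

/-- Correction of `ladderForm` for an arbitrary edge; path edges need none. -/
def ladderShift (α β : Fin m × Fin n → Bool) :
    Fin m ⊕ Fin n → Fin m ⊕ Fin n → Fin m ⊕ Fin n → ZMod 2
  | .inl i, .inr j => crossShift α β (i, j)
  | .inr j, .inl i => crossShift α β (i, j)
  | _, _ => 0

theorem isPlanar_ladderGraph (α β : Fin m × Fin n → Bool)
    (h : ∀ e ∈ cross, ∀ f ∈ cross, (if β e then f.1 < e.1 else e.1 < f.1) →
      ¬ if α e then e.2 < f.2 else f.2 < e.2) :
    IsPlanar (ladderGraph m n cross) := by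
  have hcross {i k : Fin m} {j l : Fin n} (he : (i, j) ∈ cross) (hf : (k, l) ∈ cross)
      (hik : i ≠ k) (hjl : j ≠ l) :
      (if i < k then 1 else 0) + 1 + (if l < j then 1 else 0)
        + crossShift α β (i, j) (.inl k) + crossShift α β (i, j) (.inr l)
        + crossShift α β (k, l) (.inl i) + crossShift α β (k, l) (.inr j) = 0 := by
    have h1 := h _ he _ hf
    have h2 := h _ hf _ he
    simp only [crossShift]
    rcases lt_or_gt_of_ne hik with hik | hik <;> rcases lt_or_gt_of_ne hjl with hjl | hjl <;>
      cases hα : α (i, j) <;> cases hβ : β (i, j) <;> cases hα' : α (k, l) <;>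
      cases hβ' : β (k, l) <;> simp [hα, hβ, hα', hβ', hik, hjl, hik.not_gt, hjl.not_gt]
        at h1 h2 ⊢ <;> rfl
  refine isPlanar_of_even_crossing ladderForm (ladderShift α β) ?_ ?_
  · rintro (x | x) (y | y) hxy
    · simp only [ladderForm]; grind
    · simp [ladderForm]
    · simp [ladderForm]
    · simp only [ladderForm]; grind
  · rintro (i | i) (j | j) (k | k) (l | l) hab hcd h1 h2 h3 h4
    all_goals
      simp only [ladderGraph_adj_inl_inl, ladderGraph_adj_inr_inr, ladderGraph_adj_inl_inr,
        ladderGraph_adj_inr_inl, ne_eq, Sum.inl.injEq, Sum.inr.injEq] at hab hcd h1 h2 h3 h4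
      simp only [ladderForm, ladderShift, Pi.zero_apply]
    · have e1 : i < k ↔ i < l := by omega
      have e2 : j < k ↔ j < l := by omega
      simp only [e1, e2]
      split_ifs <;> rfl
    · have e1 : i < k ↔ j < k := by omega
      have e2 : k < i ↔ k < j := by omega
      simp only [crossShift, e1, e2]
      split_ifs <;> rfl
    · have e1 : i < l ↔ j < l := by omega
      have e2 : l < i ↔ l < j := by omega
      simp only [crossShift, e1, e2]
      split_ifs <;> rfl
    · rfl
    · have e1 : i < k ↔ i < l := by omega
      simp only [crossShift, e1]
      split_ifs <;> rfl
    · linear_combination hcross hab hcd h1 h4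
    · linear_combination hcross hab hcd h2 h3
    · have e1 : k < j ↔ l < j := by omega
      simp only [crossShift, e1]
      split_ifs <;> rfl
    · have e1 : j < k ↔ j < l := by omega
      simp only [crossShift, e1]
      split_ifs <;> rfl
    · linear_combination hcross hab hcd h3 h2
    · linear_combination hcross hab hcd h4 h1
    · have e1 : k < i ↔ l < i := by omega
      simp only [crossShift, e1]
      split_ifs <;> rfl
    · rfl
    · have e1 : l < i ↔ l < j := by omega
      have e2 : i < l ↔ j < l := by omega
      simp only [crossShift, e1, e2]
      split_ifs <;> rfl
    · have e1 : k < i ↔ k < j := by omega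
      have e2 : i < k ↔ j < k := by omega
      simp only [crossShift, e1, e2]
      split_ifs <;> rfl
    · have e1 : k < i ↔ l < i := by omega
      have e2 : k < j ↔ l < j := by omega
      simp only [e1, e2]
      split_ifs <;> rfl

end Ladder

/-- **Theorem (planarity of generalized ladder graphs).**
A generalized (m,n)-ladder graph is planar iff for each cross edge `e`, at least one of the
four sets `L↑(e) ∩ R↓(e)`, `L↑(e) ∩ R↑(e)`, `L↓(e) ∩ R↑(e)`, `L↓(e) ∩ R↓(e)` is empty. -/
theorem ladder_planar_iff (m n : ℕ) (hm : 0 < m) (hn : 0 < n)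
    (cross : Finset (Fin m × Fin n)) :
    IsPlanar (ladderGraph m n cross) ↔
      ∀ e ∈ cross,
        Lup cross e ∩ Rdown cross e = ∅ ∨
        Lup cross e ∩ Rup cross e = ∅ ∨
        Ldown cross e ∩ Rup cross e = ∅ ∨
        Ldown cross e ∩ Rdown cross e = ∅ := by
  constructor
  · intro hG
    by_contra! ⟨⟨i, j⟩, he, h1, h2, h3, h4⟩
    obtain ⟨⟨a₁, a₂⟩, ha⟩ := h1
    obtain ⟨⟨b₁, b₂⟩, hb⟩ := h2
    obtain ⟨⟨c₁, c₂⟩, hc⟩ := h3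
    obtain ⟨⟨d₁, d₂⟩, hd⟩ := h4
    simp only [Lup, Ldown, Rup, Rdown, Finset.mem_inter, Finset.mem_filter] at ha hb hc hd
    exact hG.2 (containsSubdivision_k33_of_quadrants he ha.1.1 hb.1.1 hc.1.1 hd.1.1
      ha.1.2 ha.2.2 hb.1.2 hb.2.2 hc.1.2 hc.2.2 hd.1.2 hd.2.2)
  · intro h
    have key (e : Fin m × Fin n) : ∃ α β : Bool, e ∈ cross → ∀ f ∈ cross,
        (if β then f.1 < e.1 else e.1 < f.1) → ¬ if α then e.2 < f.2 else f.2 < e.2 := by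
      by_cases he : e ∈ cross
      · simp only [Lup, Ldown, Rup, Rdown, Finset.eq_empty_iff_forall_notMem, Finset.mem_inter,
          Finset.mem_filter] at h
        rcases h e he with h | h | h | h
        · exact ⟨false, false, fun _ f hf h1 h2 =>
            h f ⟨⟨hf, by simpa using h1⟩, hf, by simpa using h2⟩⟩
        · exact ⟨true, false, fun _ f hf h1 h2 =>
            h f ⟨⟨hf, by simpa using h1⟩, hf, by simpa using h2⟩⟩
        · exact ⟨true, true, fun _ f hf h1 h2 =>
            h f ⟨⟨hf, by simpa using h1⟩, hf, by simpa using h2⟩⟩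
        · exact ⟨false, true, fun _ f hf h1 h2 =>
            h f ⟨⟨hf, by simpa using h1⟩, hf, by simpa using h2⟩⟩
      · exact ⟨false, false, fun he' => absurd he' he⟩
    choose α β hαβ using key
    exact isPlanar_ladderGraph α β hαβ
end

section
/- Let G be a generalized (m,n)-ladder graph. If L↑(e) ∩ R↓(e) = L↓(e) ∩ R↑(e) = ∅ for each edge e ∈ [G₁,G₂], then G is outerplanar. -/
open SimpleGraph

/-- Every edge-endpoint pair that a walk avoids has both ends of the walk on the same side. -/
theorem SimpleGraph.Walk.between_iff_of_noncrossing {V : Type*} {G : SimpleGraph V} {pos : V → ℤ}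
    (hpos : Function.Injective pos)
    (hG : ∀ a b c d, G.Adj a c → G.Adj b d →
      ¬ (pos a < pos b ∧ pos b < pos c ∧ pos c < pos d))
    {x z : V} (hxz : G.Adj x z) {b d : V} (q : G.Walk b d) (hx : x ∉ q.support)
    (hz : z ∉ q.support) :
    (pos x < pos b ∧ pos b < pos z) ↔ (pos x < pos d ∧ pos d < pos z) := by
  induction q with
  | nil => rfl
  | @cons u v w huv q ih =>
    simp only [Walk.support_cons, List.mem_cons, not_or] at hx hz
    rw [← ih hx.2 hz.2]
    have hv := q.start_mem_support
    have h₁ : pos x ≠ pos u := fun e => hx.1 (hpos e)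
    have h₂ : pos z ≠ pos u := fun e => hz.1 (hpos e)
    have h₃ : pos x ≠ pos v := fun e => hx.2 (hpos e ▸ hv)
    have h₄ : pos z ≠ pos v := fun e => hz.2 (hpos e ▸ hv)
    have k₁ := hG _ _ _ _ hxz huv
    have k₂ := hG _ _ _ _ hxz huv.symm
    have k₃ := hG _ _ _ _ huv hxz
    have k₄ := hG _ _ _ _ huv.symm hxz
    omega

/-- If no two edges cross, then two vertex-disjoint walks do not cross either. -/
theorem SimpleGraph.Walk.not_crossing_of_noncrossing {V : Type*} {G : SimpleGraph V} {pos : V → ℤ}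
    (hpos : Function.Injective pos)
    (hG : ∀ a b c d, G.Adj a c → G.Adj b d →
      ¬ (pos a < pos b ∧ pos b < pos c ∧ pos c < pos d))
    {b d : V} (q : G.Walk b d) {a c : V} (p : G.Walk a c) (hpq : p.support.Disjoint q.support) :
    (pos b < pos a ∧ pos a < pos d) ↔ (pos b < pos c ∧ pos c < pos d) := by
  induction p with
  | nil => rfl
  | @cons u v w huv p ih =>
    simp only [Walk.support_cons, List.disjoint_cons_left] at hpq
    rw [← ih hpq.2]
    have hv : v ∉ q.support := fun hv => hpq.2 p.start_mem_support hv
    have h₁ : pos b ≠ pos u := fun e => hpq.1 (hpos e ▸ q.start_mem_support)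
    have h₂ : pos d ≠ pos u := fun e => hpq.1 (hpos e ▸ q.end_mem_support)
    have h₃ : pos b ≠ pos v := fun e => hv (hpos e ▸ q.start_mem_support)
    have h₄ : pos d ≠ pos v := fun e => hv (hpos e ▸ q.end_mem_support)
    have k₁ := q.between_iff_of_noncrossing hpos hG huv hpq.1 hv
    have k₂ := q.between_iff_of_noncrossing hpos hG huv.symm hv hpq.1
    omega

/-- A graph with an injective placement of its vertices on a line such that no two edges,
drawn as arcs above the line, cross is outerplanar. -/
theorem isOuterplanar_of_noncrossing {V : Type*} {G : SimpleGraph V} {pos : V → ℤ}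
    (hpos : Function.Injective pos)
    (hG : ∀ a b c d, G.Adj a c → G.Adj b d →
      ¬ (pos a < pos b ∧ pos b < pos c ∧ pos c < pos d)) :
    IsOuterplanar G := by
  have key : ∀ {W : Type} {H : SimpleGraph W} {f : W → V} (_ : Function.Injective f)
      {p : ∀ ⦃a b : W⦄, H.Adj a b → G.Walk (f a) (f b)}
      (_ : ∀ ⦃a b a' b' : W⦄ (h : H.Adj a b) (h' : H.Adj a' b'), s(a, b) ≠ s(a', b') →
        ∀ v, v ∈ (p h).support → v ∈ (p h').support →
          (v = f a ∨ v = f b) ∧ (v = f a' ∨ v = f b'))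
      {a b c d : W}, H.Adj a c → H.Adj b d → a ≠ b → a ≠ d → c ≠ b → c ≠ d →
      ((pos (f b) < pos (f a) ∧ pos (f a) < pos (f d)) ↔
        (pos (f b) < pos (f c) ∧ pos (f c) < pos (f d))) := by
    intro W H f hf p hp a b c d hac hbd hab had hcb hcd
    refine (p hbd).not_crossing_of_noncrossing hpos hG (p hac) fun v hv hv' => ?_
    have hne : s(a, c) ≠ s(b, d) := by simp [hab, had]
    obtain ⟨h₁ | h₁, h₂ | h₂⟩ := hp hac hbd hne v hv hv'
    exacts [hab (hf (h₁.symm.trans h₂)), had (hf (h₁.symm.trans h₂)),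
      hcb (hf (h₁.symm.trans h₂)), hcd (hf (h₁.symm.trans h₂))]
  constructor
  · rintro ⟨f, hf, p, -, -, hp⟩
    set σ := Tuple.sort (pos ∘ f)
    have hσ : StrictMono ((pos ∘ f) ∘ σ) :=
      (Tuple.monotone_sort (pos ∘ f)).strictMono_of_injective
        ((hpos.comp hf).comp σ.injective)
    have hne : ∀ {i j : Fin 4}, i ≠ j → σ i ≠ σ j := fun h e => h (σ.injective e)
    have h := key hf hp (a := σ 0) (b := σ 1) (c := σ 2) (d := σ 3)
      (hne (by decide)) (hne (by decide)) (hne (by decide)) (hne (by decide)) (hne (by decide))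
      (hne (by decide))
    have h₁ : pos (f (σ 0)) < pos (f (σ 1)) := hσ (by decide)
    have h₂ : pos (f (σ 1)) < pos (f (σ 2)) := hσ (by decide)
    have h₃ : pos (f (σ 2)) < pos (f (σ 3)) := hσ (by decide)
    omega
  · rintro ⟨f, hf, p, -, -, hp⟩
    have hne : ∀ {i j}, i ≠ j → pos (f i) ≠ pos (f j) := fun h e => h (hf (hpos e))
    have hleaf : ∀ {i j : Fin 3} {k l : Fin 2}, i ≠ j → k ≠ l →
        pos (f (.inr k)) < pos (f (.inr l)) →
        ((pos (f (.inr k)) < pos (f (.inl i)) ∧ pos (f (.inl i)) < pos (f (.inr l))) ↔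
          ¬ (pos (f (.inr k)) < pos (f (.inl j)) ∧ pos (f (.inl j)) < pos (f (.inr l)))) := by
      intro i j k l hij hkl hlt
      have aux : ∀ {i j : Fin 3} {k l : Fin 2}, i ≠ j → k ≠ l → _ := fun {i j k l} hij hkl =>
        key hf hp (a := .inl i) (c := .inr k) (b := .inl j) (d := .inr l) (by simp) (by simp)
          (by simpa using hij) (by simp) (by simp) (by simpa using hkl)
      have aux' : ∀ {i j : Fin 3} {k l : Fin 2}, i ≠ j → k ≠ l → _ := fun {i j k l} hij hkl =>
        key hf hp (a := .inl i) (c := .inr k) (b := .inr l) (d := .inl j) (by simp) (by simp)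
          (by simp) (by simpa using hij) (by simpa using hkl) (by simp)
      have h₁ := aux hij hkl
      have h₂ := aux hij hkl.symm
      have h₃ := aux hij.symm hkl
      have h₄ := aux hij.symm hkl.symm
      have h₅ := aux' hij hkl
      have h₆ := aux' hij hkl.symm
      have h₇ := aux' hij.symm hkl
      have h₈ := aux' hij.symm hkl.symm
      have n₁ := hne (i := .inl i) (j := .inl j) (by simpa using hij)
      have n₂ := hne (i := .inl i) (j := .inr k) (by simp)
      have n₃ := hne (i := .inl i) (j := .inr l) (by simp)
      have n₄ := hne (i := .inl j) (j := .inr k) (by simp)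
      have n₅ := hne (i := .inl j) (j := .inr l) (by simp)
      omega
    have hthree : ∀ {k l : Fin 2}, k ≠ l → ¬ pos (f (.inr k)) < pos (f (.inr l)) := by
      intro k l hkl hlt
      have h₁ := hleaf (i := 0) (j := 1) (by decide) hkl hlt
      have h₂ := hleaf (i := 0) (j := 2) (by decide) hkl hlt
      have h₃ := hleaf (i := 1) (j := 2) (by decide) hkl hlt
      tauto
    exact (lt_or_gt_of_ne (hne (i := .inr 0) (j := .inr 1) (by simp))).elim
      (hthree (by decide)) (hthree (by decide))

/-- If `L↑(e) ∩ R↓(e) = L↓(e) ∩ R↑(e) = ∅` for each cross edge `e`, then the generalized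
ladder graph is outerplanar. -/
theorem ladder_outerplanar_of_forall' (m n : ℕ) (hm : 0 < m) (hn : 0 < n)
    (cross : Finset (Fin m × Fin n))
    (h : ∀ e ∈ cross,
        Lup cross e ∩ Rdown cross e = ∅ ∧ Ldown cross e ∩ Rup cross e = ∅) :
    IsOuterplanar (ladderGraph m n cross) := by
  have hmono : ∀ e ∈ cross, ∀ e' ∈ cross, e.1 < e'.1 → e.2 ≤ e'.2 := by
    intro e he e' he' hlt
    by_contra! hlt'
    have hmem : e' ∈ Lup cross e ∩ Rdown cross e := by
      simp [Lup, Rdown, he', hlt, hlt']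
    simp [(h e he).1] at hmem
  let pos : Fin m ⊕ Fin n → ℤ := Sum.elim (fun i => (i : ℤ)) (fun j => (m : ℤ) + n - j)
  have hinl : ∀ i, pos (.inl i) = (i : ℤ) := fun _ => rfl
  have hinr : ∀ j, pos (.inr j) = (m : ℤ) + n - j := fun _ => rfl
  refine isOuterplanar_of_noncrossing (pos := pos) ?_ ?_
  · rintro (i | i) (j | j) hij <;> simp only [hinl, hinr] at hij
    · exact congrArg _ (Fin.ext (by omega))
    · omega
    · omega
    · exact congrArg _ (Fin.ext (by omega))
  · rintro (a | a) (b | b) (c | c) (d | d) hac hbd <;>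
      simp only [ladderGraph, SimpleGraph.fromRel_adj, ladderRel, or_false, false_or] at hac hbd <;>
      simp only [hinl, hinr] <;> rintro ⟨h₁, h₂, h₃⟩ <;> try omega
    have := hmono _ hac.2 _ hbd.2 (by simp only [Fin.lt_def]; omega)
    simp only [Fin.le_def] at this
    omega
end

section
/- Let G be a generalized (m,n)-ladder graph. If L↑(e) ∩ R↑(e) = L↓(e) ∩ R↓(e) = ∅ for each edge e ∈ [G₁,G₂], then G is outerplanar. -/
open SimpleGraph

/-- `x` lies strictly between `p` and `q`. -/
def StrictlyBetween (x p q : ℕ) : Prop := (p < x ∧ x < q) ∨ (q < x ∧ x < p)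

/-- A predicate preserved by every edge among the vertices of a walk agrees at its endpoints. -/
theorem walk_iff_of_adj_iff {V : Type*} {G : SimpleGraph V} (S : V → Prop) {a b : V}
    (P : G.Walk a b)
    (hS : ∀ x ∈ P.support, ∀ y ∈ P.support, G.Adj x y → (S x ↔ S y)) : S a ↔ S b := by
  induction P with
  | nil => rfl
  | cons hadj P ih =>
    refine (hS _ (by simp) _ (by simp) hadj).trans (ih fun x hx y hy hxy => ?_)
    exact hS x (by simp [hx]) y (by simp [hy]) hxy

/-- The edges of `G` are pairwise noncrossing chords when its vertices are placed on a line
at the positions `φ`. -/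
def NoncrossingAt {V : Type*} (G : SimpleGraph V) (φ : V → ℕ) : Prop :=
  ∀ ⦃a b c d : V⦄, G.Adj a b → G.Adj c d → ¬ (φ a < φ c ∧ φ c < φ b ∧ φ b < φ d)

/-- Vertex-disjoint walks in a noncrossing graph have noncrossing pairs of endpoints. -/
theorem strictlyBetween_iff_of_disjoint_walks {V : Type*} {G : SimpleGraph V} {φ : V → ℕ}
    (hφ : Function.Injective φ) (hG : NoncrossingAt G φ) {a b c d : V}
    (P : G.Walk a b) (Q : G.Walk c d) (hPQ : ∀ v ∈ P.support, v ∉ Q.support) :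
    StrictlyBetween (φ c) (φ a) (φ b) ↔ StrictlyBetween (φ d) (φ a) (φ b) := by
  have hne : ∀ x ∈ P.support, ∀ y ∈ Q.support, φ x ≠ φ y := fun x hx y hy hxy =>
    hPQ x hx (hφ hxy ▸ hy)
  refine walk_iff_of_adj_iff (fun v => StrictlyBetween (φ v) (φ a) (φ b)) Q
    fun q hq q' hq' hadj => ?_
  have key : StrictlyBetween (φ a) (φ q) (φ q') ↔ StrictlyBetween (φ b) (φ q) (φ q') := by
    refine walk_iff_of_adj_iff (fun v => StrictlyBetween (φ v) (φ q) (φ q')) P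
      fun x hx y hy hxy => ?_
    have h₁ := hne x hx q hq
    have h₂ := hne x hx q' hq'
    have h₃ := hne y hy q hq
    have h₄ := hne y hy q' hq'
    have c₁ := hG hxy hadj
    have c₂ := hG hxy hadj.symm
    have c₃ := hG hxy.symm hadj
    have c₄ := hG hxy.symm hadj.symm
    have c₅ := hG hadj hxy
    have c₆ := hG hadj hxy.symm
    have c₇ := hG hadj.symm hxy
    have c₈ := hG hadj.symm hxy.symm
    unfold StrictlyBetween
    omega
  have h₁ := hne a P.start_mem_support q hq
  have h₂ := hne a P.start_mem_support q' hq'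
  have h₃ := hne b P.end_mem_support q hq
  have h₄ := hne b P.end_mem_support q' hq'
  unfold StrictlyBetween at *
  omega

/-- A subdivision of `H` in a noncrossing graph places the branch vertices so that disjoint
edges of `H` do not cross. -/
theorem ContainsSubdivision.exists_noncrossing {V W : Type*} {G : SimpleGraph V}
    {H : SimpleGraph W} {φ : V → ℕ} (hφ : Function.Injective φ) (hG : NoncrossingAt G φ)
    (hsub : ContainsSubdivision G H) :
    ∃ g : W → ℕ, Function.Injective g ∧ ∀ a b c d : W, H.Adj a b → H.Adj c d →
      a ≠ c → a ≠ d → b ≠ c → b ≠ d →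
      (StrictlyBetween (g c) (g a) (g b) ↔ StrictlyBetween (g d) (g a) (g b)) := by
  obtain ⟨f, hf, p, -, -, hdisj⟩ := hsub
  refine ⟨φ ∘ f, hφ.comp hf, fun a b c d hab hcd hac had hbc hbd => ?_⟩
  refine strictlyBetween_iff_of_disjoint_walks hφ hG (p hab) (p hcd) fun v hv hv' => ?_
  obtain ⟨h₁, h₂⟩ := hdisj hab hcd (by simp [hac, had]) v hv hv'
  rcases h₁ with rfl | rfl <;> rcases h₂ with h₂ | h₂ <;> have := hf h₂ <;> contradiction

/-- Of the three ways to pair up four points on a line, one is crossing. -/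
theorem not_all_pairings_noncrossing {a b c d : ℕ} (hab : a ≠ b) (hac : a ≠ c) (had : a ≠ d)
    (hbc : b ≠ c) (hbd : b ≠ d) (hcd : c ≠ d)
    (h₁ : StrictlyBetween c a b ↔ StrictlyBetween d a b)
    (h₂ : StrictlyBetween b a c ↔ StrictlyBetween d a c)
    (h₃ : StrictlyBetween b a d ↔ StrictlyBetween c a d) : False := by
  unfold StrictlyBetween at *
  grind

/-- If neither `ac` crosses `bd` nor `bc` crosses `ad`, then `cd` separates `a` from `b`. -/
theorem not_strictlyBetween_iff_of_noncrossing {a b c d : ℕ} (hab : a ≠ b) (hac : a ≠ c)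
    (had : a ≠ d) (hbc : b ≠ c) (hbd : b ≠ d) (hcd : c ≠ d)
    (h₁ : StrictlyBetween b a c ↔ StrictlyBetween d a c)
    (h₂ : StrictlyBetween a b c ↔ StrictlyBetween d b c) :
    ¬ (StrictlyBetween a c d ↔ StrictlyBetween b c d) := by
  unfold StrictlyBetween at *
  grind

/-- A graph whose edges are noncrossing chords is outerplanar. -/
theorem NoncrossingAt.isOuterplanar {V : Type*} {G : SimpleGraph V} {φ : V → ℕ}
    (hφ : Function.Injective φ) (hG : NoncrossingAt G φ) : IsOuterplanar G := by
  constructor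
  · intro hsub
    obtain ⟨g, hg, hcross⟩ := hsub.exists_noncrossing hφ hG
    have hne : ∀ i j, i ≠ j → g i ≠ g j := fun i j hij => hg.ne hij
    have n₁ := hne 0 1 (by decide)
    have n₂ := hne 0 2 (by decide)
    have n₃ := hne 0 3 (by decide)
    have n₄ := hne 1 2 (by decide)
    have n₅ := hne 1 3 (by decide)
    have n₆ := hne 2 3 (by decide)
    have c₁ := hcross 0 1 2 3 (by simp) (by simp) (by decide) (by decide) (by decide) (by decide)
    have c₂ := hcross 0 2 1 3 (by simp) (by simp) (by decide) (by decide) (by decide) (by decide)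
    have c₃ := hcross 0 3 1 2 (by simp) (by simp) (by decide) (by decide) (by decide) (by decide)
    exact not_all_pairings_noncrossing n₁ n₂ n₃ n₄ n₅ n₆ c₁ c₂ c₃
  · intro hsub
    obtain ⟨g, hg, hcross⟩ := hsub.exists_noncrossing hφ hG
    have hlr : ∀ i j, g (Sum.inl i) ≠ g (Sum.inr j) := fun i j => hg.ne (by simp)
    have hll : ∀ i j, i ≠ j → g (Sum.inl i) ≠ g (Sum.inl j) := fun i j hij => hg.ne (by simpa)
    have hrr : g (Sum.inr 0) ≠ g (Sum.inr 1) := hg.ne (by simp)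
    -- two of the three vertices on one side cannot lie in the same arc cut out by the other side
    have arc : ∀ i j, i ≠ j →
        ¬ (StrictlyBetween (g (Sum.inl i)) (g (Sum.inr 0)) (g (Sum.inr 1)) ↔
          StrictlyBetween (g (Sum.inl j)) (g (Sum.inr 0)) (g (Sum.inr 1))) := by
      intro i j hij
      have c₁ := hcross (Sum.inl i) (Sum.inr 0) (Sum.inl j) (Sum.inr 1)
        (by simp) (by simp) (by simpa) (by simp) (by simp) (by simp)
      have c₂ := hcross (Sum.inl j) (Sum.inr 0) (Sum.inl i) (Sum.inr 1)
        (by simp) (by simp) (by simpa using hij.symm) (by simp) (by simp) (by simp)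
      exact not_strictlyBetween_iff_of_noncrossing (hll i j hij) (hlr i 0) (hlr i 1) (hlr j 0)
        (hlr j 1) hrr c₁ c₂
    have a₁ := arc 0 1 (by decide)
    have a₂ := arc 0 2 (by decide)
    have a₃ := arc 1 2 (by decide)
    tauto

/-- Positions of the vertices of a ladder on a line: the first path followed by the second. -/
def ladderPosition (m n : ℕ) : Fin m ⊕ Fin n → ℕ :=
  Sum.elim (fun i => (i : ℕ)) (fun j => m + j)

theorem ladderPosition_injective (m n : ℕ) : Function.Injective (ladderPosition m n) := by
  rintro (i | i) (j | j) hij <;> simp only [ladderPosition, Sum.elim_inl, Sum.elim_inr] at hij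
  · exact congrArg _ (Fin.ext hij)
  · omega
  · omega
  · exact congrArg _ (Fin.ext (by omega))

theorem ladderGraph_noncrossingAt (m n : ℕ) (cross : Finset (Fin m × Fin n))
    (h : ∀ e ∈ cross, Lup cross e ∩ Rup cross e = ∅) :
    NoncrossingAt (ladderGraph m n cross) (ladderPosition m n) := by
  have anti : ∀ i j i' j', (i, j) ∈ cross → (i', j') ∈ cross →
      ¬ ((i : ℕ) < i' ∧ (j : ℕ) < j') := by
    rintro i j i' j' he he' ⟨hi, hj⟩
    have hmem : (i', j') ∈ Lup cross (i, j) ∩ Rup cross (i, j) :=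
      Finset.mem_inter.2 ⟨Finset.mem_filter.2 ⟨he', hi⟩, Finset.mem_filter.2 ⟨he', hj⟩⟩
    simp [h _ he] at hmem
  rintro (a | a) (b | b) (c | c) (d | d) hab hcd <;>
    simp only [ladderGraph, SimpleGraph.fromRel_adj, ladderRel, or_false, false_or] at hab hcd <;>
    simp only [ladderPosition, Sum.elim_inl, Sum.elim_inr] <;>
    first
    | omega
    | have := anti _ _ _ _ hab.2 hcd.2
      omega

/-- If `L↑(e) ∩ R↑(e) = L↓(e) ∩ R↓(e) = ∅` for each cross edge `e`, then the generalized
ladder graph is outerplanar. -/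
theorem ladder_outerplanar_of_forall (m n : ℕ) (hm : 0 < m) (hn : 0 < n)
    (cross : Finset (Fin m × Fin n))
    (h : ∀ e ∈ cross,
        Lup cross e ∩ Rup cross e = ∅ ∧ Ldown cross e ∩ Rdown cross e = ∅) :
    IsOuterplanar (ladderGraph m n cross) := by
  exact (ladderGraph_noncrossingAt m n cross fun e he => (h e he).1).isOuterplanar
    (ladderPosition_injective m n)
end

section
/- Let G be a generalized (m,n)-ladder graph. If there is an edge e ∈ [G₁,G₂] such that (a) L↑(e) ∩ R↑(e) ≠ ∅ or L↓(e) ∩ R↓(e) ≠ ∅, and (b) L↑(e) ∩ R↓(e) ≠ ∅ or L↓(e) ∩ R↑(e) ≠ ∅, then G is not outerplanar. -/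
open SimpleGraph

/-- Consecutive adjacency along a sequence of vertices gives walks between any two of its
members that stay in the corresponding segment. -/
theorem exists_walk_support_subset_image_Icc {V : Type*} {G : SimpleGraph V} {m : ℕ}
    {u : Fin m → V} (hu : ∀ a b : Fin m, (a : ℕ) + 1 = b → G.Adj (u a) (u b))
    {a b : Fin m} (hab : a ≤ b) :
    ∃ w : G.Walk (u a) (u b), ∀ z ∈ w.support, z ∈ u '' Set.Icc a b := by
  obtain ⟨b, hb⟩ := b
  induction b with
  | zero =>
    obtain rfl : a = ⟨0, hb⟩ := le_antisymm hab (Nat.zero_le _)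
    exact ⟨.nil, by simp⟩
  | succ b ih =>
    rcases hab.eq_or_lt with rfl | h
    · exact ⟨.nil, by simp⟩
    · obtain ⟨w, hw⟩ := ih (by omega) (Nat.lt_succ_iff.mp h)
      refine ⟨w.concat (hu ⟨b, by omega⟩ ⟨b + 1, hb⟩ rfl), fun z hz => ?_⟩
      rw [Walk.support_concat, List.mem_append,
        List.mem_singleton] at hz
      rcases hz with hz | rfl
      · obtain ⟨c, hc, rfl⟩ := hw z hz
        exact ⟨c, ⟨hc.1, hc.2.trans (Fin.mk_le_mk.mpr b.le_succ)⟩, rfl⟩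
      · exact ⟨_, ⟨hab, le_rfl⟩, rfl⟩

/-- A family of walks from `c k` to `b l`, running in sets `S k l` that meet only in common
end vertices, yields a subdivision of a complete bipartite graph. -/
theorem containsSubdivision_completeBipartiteGraph {V α β : Type*} {G : SimpleGraph V}
    {c : α → V} {b : β → V} (hf : Function.Injective (Sum.elim c b)) (S : α → β → Set V)
    (hw : ∀ k l, ∃ w : G.Walk (c k) (b l), ∀ z ∈ w.support, z ∈ S k l)
    (hc : ∀ k l k', c k' ∈ S k l → k' = k) (hb : ∀ k l l', b l' ∈ S k l → l' = l)
    (hS : ∀ k l k' l', (k, l) ≠ (k', l') → ∀ z ∈ S k l, z ∈ S k' l' →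
      (z = c k ∧ k = k') ∨ (z = b l ∧ l = l')) :
    ContainsSubdivision G (completeBipartiteGraph α β) := by
  classical
  have key : ∀ x y : α ⊕ β, (completeBipartiteGraph α β).Adj x y →
      ∃ p : G.Walk (Sum.elim c b x) (Sum.elim c b y), p.IsPath ∧
        ∃ k l, s(x, y) = s(Sum.inl k, Sum.inr l) ∧ ∀ z ∈ p.support, z ∈ S k l := by
    rintro (k | l) (k' | l') h
    · simp at h
    · obtain ⟨w, hw⟩ := hw k l'
      exact ⟨w.bypass, w.bypass_isPath, k, l', rfl,
        fun z hz => hw z (w.support_bypass_subset_support hz)⟩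
    · obtain ⟨w, hw⟩ := hw k' l
      exact ⟨w.bypass.reverse, w.bypass_isPath.reverse, k', l, Sym2.eq_swap,
        fun z hz => hw z (w.support_bypass_subset_support (by simpa using hz))⟩
    · simp at h
  choose p hp k l hs hsup using key
  refine ⟨Sum.elim c b, hf, fun x y h => p x y h, fun x y h => hp x y h, ?_, ?_⟩
  · intro x y h t ht
    have h1 := hsup x y h _ ht
    have : t ∈ s(x, y) := by
      rw [hs x y h]
      rcases t with t | t
      · simp [hc _ _ _ h1]
      · simp [hb _ _ _ h1]
    simpa using this
  · intro x y x' y' h h' hne z hz hz'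
    have h1 := hS (k x y h) (l x y h) (k x' y' h') (l x' y' h')
      (fun he => hne (by rw [hs x y h, hs x' y' h', (Prod.mk.inj he).1, (Prod.mk.inj he).2]))
      z (hsup _ _ _ _ hz) (hsup _ _ _ _ hz')
    have mem : ∀ {t x y}, t ∈ s(x, y) → z = Sum.elim c b t →
        z = Sum.elim c b x ∨ z = Sum.elim c b y := by
      intro t x y ht hzt
      rcases Sym2.mem_iff.mp ht with rfl | rfl <;> simp [hzt]
    rcases h1 with ⟨hzc, hk⟩ | ⟨hzb, hl⟩
    · exact ⟨mem (t := Sum.inl (k x y h)) (by rw [hs x y h]; simp) hzc,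
        mem (t := Sum.inl (k x y h)) (by rw [hs x' y' h', hk]; simp) hzc⟩
    · exact ⟨mem (t := Sum.inr (l x y h)) (by rw [hs x y h]; simp) hzb,
        mem (t := Sum.inr (l x y h)) (by rw [hs x' y' h', hl]; simp) hzb⟩

set_option maxHeartbeats 2000000 in
/-- Two disjoint paths with cross edges at `(i, j)`, `(i₁, j₁)`, `(i₂, j₂)`, where
`i < i₁ ≤ i₂` and `j` lies strictly between `j₁` and `j₂`, contain a subdivision of `K₃,₂`. -/
theorem containsSubdivision_of_lt_of_le {V : Type*} {G : SimpleGraph V} {m n : ℕ}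
    {u : Fin m → V} {v : Fin n → V} (huv : Function.Injective (Sum.elim u v))
    (hu : ∀ a b : Fin m, (a : ℕ) + 1 = b → G.Adj (u a) (u b))
    (hv : ∀ a b : Fin n, (a : ℕ) + 1 = b → G.Adj (v a) (v b))
    {i i₁ i₂ : Fin m} {j j₁ j₂ : Fin n} (he : G.Adj (u i) (v j))
    (h₁ : G.Adj (u i₁) (v j₁)) (h₂ : G.Adj (u i₂) (v j₂)) (hi : i < i₁) (hi' : i₁ ≤ i₂)
    (hj : j₂ < j) (hj' : j < j₁) :
    ContainsSubdivision G (completeBipartiteGraph (Fin 3) (Fin 2)) := by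
  let C : Fin 3 → Fin m ⊕ Fin n := ![.inl i, .inr j₁, .inr j₂]
  let B : Fin 2 → Fin m ⊕ Fin n := ![.inr j, .inl i₁]
  let T : Fin 3 → Fin 2 → Set (Fin m ⊕ Fin n) :=
    ![![{.inl i, .inr j}, Sum.inl '' Set.Icc i i₁],
      ![Sum.inr '' Set.Icc j j₁, {.inr j₁, .inl i₁}],
      ![Sum.inr '' Set.Icc j₂ j, insert (.inr j₂) (Sum.inl '' Set.Icc i₁ i₂)]]
  have hCB : Function.Injective (Sum.elim C B) := by
    rintro (a | a) (b | b) hab <;> fin_cases a <;> fin_cases b <;> simp [C, B] at hab ⊢ <;> omega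
  have hf : Sum.elim (fun k => Sum.elim u v (C k)) (fun l => Sum.elim u v (B l)) =
      Sum.elim u v ∘ Sum.elim C B := by
    ext (a | a) <;> rfl
  have w₀₀ : ∃ w : G.Walk (u i) (v j), ∀ z ∈ w.support, z ∈ Sum.elim u v '' T 0 0 :=
    ⟨.cons he .nil, by simp [T, eq_comm]⟩
  have w₀₁ : ∃ w : G.Walk (u i) (u i₁), ∀ z ∈ w.support, z ∈ Sum.elim u v '' T 0 1 := by
    obtain ⟨w, hw⟩ := exists_walk_support_subset_image_Icc hu hi.le
    exact ⟨w, by simpa [T, Set.image_image] using hw⟩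
  have w₁₀ : ∃ w : G.Walk (v j₁) (v j), ∀ z ∈ w.support, z ∈ Sum.elim u v '' T 1 0 := by
    obtain ⟨w, hw⟩ := exists_walk_support_subset_image_Icc hv hj'.le
    exact ⟨w.reverse, by simpa [T, Set.image_image] using hw⟩
  have w₁₁ : ∃ w : G.Walk (v j₁) (u i₁), ∀ z ∈ w.support, z ∈ Sum.elim u v '' T 1 1 :=
    ⟨.cons h₁.symm .nil, by simp [T, eq_comm]⟩
  have w₂₀ : ∃ w : G.Walk (v j₂) (v j), ∀ z ∈ w.support, z ∈ Sum.elim u v '' T 2 0 := by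
    obtain ⟨w, hw⟩ := exists_walk_support_subset_image_Icc hv hj.le
    exact ⟨w, by simpa [T, Set.image_image] using hw⟩
  have w₂₁ : ∃ w : G.Walk (v j₂) (u i₁), ∀ z ∈ w.support, z ∈ Sum.elim u v '' T 2 1 := by
    obtain ⟨w, hw⟩ := exists_walk_support_subset_image_Icc hu hi'
    refine ⟨.cons h₂.symm w.reverse, fun z hz => ?_⟩
    simp only [Walk.support_cons, List.mem_cons, Walk.support_reverse, List.mem_reverse] at hz
    rcases hz with rfl | hz
    · exact ⟨.inr j₂, by simp [T], rfl⟩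
    · obtain ⟨x, hx, rfl⟩ := hw z hz
      exact ⟨.inl x, Or.inr ⟨x, hx, rfl⟩, rfl⟩
  have hT : ∀ k l k' l', (k, l) ≠ (k', l') → ∀ x ∈ T k l, x ∈ T k' l' →
      (x = C k ∧ k = k') ∨ (x = B l ∧ l = l') := by
    clear w₀₀ w₀₁ w₁₀ w₁₁ w₂₀ w₂₁ hf hCB huv
    intro k l k' l' hne x hx hx'
    fin_cases k <;> fin_cases l <;> fin_cases k' <;> fin_cases l' <;>
      first
      | exact absurd rfl hne
      | (clear hne; rcases x with x | x <;> simp [B, C, T] at hx hx' ⊢ <;> omega)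
  refine containsSubdivision_completeBipartiteGraph
    (c := fun k => Sum.elim u v (C k)) (b := fun l => Sum.elim u v (B l))
    (hf ▸ huv.comp hCB) (fun k l => Sum.elim u v '' T k l) ?_ ?_ ?_ ?_
  · intro k l
    fin_cases k <;> fin_cases l
    exacts [w₀₀, w₀₁, w₁₀, w₁₁, w₂₀, w₂₁]
  · intro k l k' hk
    rw [huv.mem_set_image] at hk
    fin_cases k <;> fin_cases l <;> fin_cases k' <;> simp [C, T] at hk ⊢ <;> omega
  · intro k l l' hl
    rw [huv.mem_set_image] at hl
    fin_cases k <;> fin_cases l <;> fin_cases l' <;> simp [B, T] at hl ⊢ <;> omega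
  · rintro k l k' l' hne _ ⟨x, hx, rfl⟩ hx'
    rw [huv.mem_set_image] at hx'
    simp only [huv.eq_iff]
    exact hT k l k' l' hne x hx hx'

/-- Two disjoint paths with cross edges at `(i, j)`, `(i₁, j₁)`, `(i₂, j₂)`, where
`i < i₁, i₂` and `j₂ < j < j₁`, contain a subdivision of `K₃,₂`. -/
theorem containsSubdivision_of_lt {V : Type*} {G : SimpleGraph V} {m n : ℕ}
    {u : Fin m → V} {v : Fin n → V} (huv : Function.Injective (Sum.elim u v))
    (hu : ∀ a b : Fin m, (a : ℕ) + 1 = b → G.Adj (u a) (u b))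
    (hv : ∀ a b : Fin n, (a : ℕ) + 1 = b → G.Adj (v a) (v b))
    {i i₁ i₂ : Fin m} {j j₁ j₂ : Fin n} (he : G.Adj (u i) (v j))
    (h₁ : G.Adj (u i₁) (v j₁)) (h₂ : G.Adj (u i₂) (v j₂)) (hi₁ : i < i₁) (hi₂ : i < i₂)
    (hj : j₂ < j) (hj' : j < j₁) :
    ContainsSubdivision G (completeBipartiteGraph (Fin 3) (Fin 2)) := by
  rcases le_total i₁ i₂ with h | h
  · exact containsSubdivision_of_lt_of_le huv hu hv he h₁ h₂ hi₁ h hj hj'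
  · have hr : Sum.elim u (v ∘ Fin.rev) = Sum.elim u v ∘ Sum.map id Fin.rev := by
      ext (a | a) <;> rfl
    refine containsSubdivision_of_lt_of_le (u := u) (v := v ∘ Fin.rev)
      (i := i) (i₁ := i₂) (i₂ := i₁) (j := j.rev) (j₁ := j₂.rev) (j₂ := j₁.rev)
      (hr ▸ huv.comp (Function.Injective.sumMap Function.injective_id Fin.rev_injective))
      hu (fun a b hab => (hv _ _ ?_).symm) ?_ ?_ ?_ hi₂ h
      (Fin.rev_lt_rev.mpr hj') (Fin.rev_lt_rev.mpr hj)
    · simp only [Fin.val_rev]; omega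
    all_goals simpa

/-- Version of `containsSubdivision_of_lt` for `i₁, i₂ < i`. -/
theorem containsSubdivision_of_gt {V : Type*} {G : SimpleGraph V} {m n : ℕ}
    {u : Fin m → V} {v : Fin n → V} (huv : Function.Injective (Sum.elim u v))
    (hu : ∀ a b : Fin m, (a : ℕ) + 1 = b → G.Adj (u a) (u b))
    (hv : ∀ a b : Fin n, (a : ℕ) + 1 = b → G.Adj (v a) (v b))
    {i i₁ i₂ : Fin m} {j j₁ j₂ : Fin n} (he : G.Adj (u i) (v j))
    (h₁ : G.Adj (u i₁) (v j₁)) (h₂ : G.Adj (u i₂) (v j₂)) (hi₁ : i₁ < i) (hi₂ : i₂ < i)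
    (hj : j₂ < j) (hj' : j < j₁) :
    ContainsSubdivision G (completeBipartiteGraph (Fin 3) (Fin 2)) := by
  have hr : Sum.elim (u ∘ Fin.rev) v = Sum.elim u v ∘ Sum.map Fin.rev id := by
    ext (a | a) <;> rfl
  refine containsSubdivision_of_lt (u := u ∘ Fin.rev) (v := v)
    (i := i.rev) (i₁ := i₁.rev) (i₂ := i₂.rev) (j := j) (j₁ := j₁) (j₂ := j₂)
    (hr ▸ huv.comp (Function.Injective.sumMap Fin.rev_injective Function.injective_id))
    (fun a b hab => (hu _ _ ?_).symm) hv ?_ ?_ ?_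
    (Fin.rev_lt_rev.mpr hi₁) (Fin.rev_lt_rev.mpr hi₂) hj hj'
  · simp only [Fin.val_rev]; omega
  all_goals simpa

/-- If there is a cross edge `e` with (a) `L↑(e) ∩ R↑(e) ≠ ∅` or `L↓(e) ∩ R↓(e) ≠ ∅`, and
(b) `L↑(e) ∩ R↓(e) ≠ ∅` or `L↓(e) ∩ R↑(e) ≠ ∅`, then the generalized ladder graph is not
outerplanar. -/
theorem ladder_not_outerplanar_of_edge (m n : ℕ) (hm : 0 < m) (hn : 0 < n)
    (cross : Finset (Fin m × Fin n)) (e : Fin m × Fin n) (he : e ∈ cross)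
    (ha : (Lup cross e ∩ Rup cross e).Nonempty ∨ (Ldown cross e ∩ Rdown cross e).Nonempty)
    (hb : (Lup cross e ∩ Rdown cross e).Nonempty ∨ (Ldown cross e ∩ Rup cross e).Nonempty) :
    ¬ IsOuterplanar (ladderGraph m n cross) := by
  have huv : Function.Injective (Sum.elim (Sum.inl : Fin m → Fin m ⊕ Fin n) Sum.inr) := by
    rw [Sum.elim_inl_inr]; exact Function.injective_id
  have hvu : Function.Injective (Sum.elim (Sum.inr : Fin n → Fin m ⊕ Fin n) Sum.inl) :=
    Sum.swap_rightInverse.injective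
  have hu : ∀ a b : Fin m, (a : ℕ) + 1 = b →
      (ladderGraph m n cross).Adj (Sum.inl a) (Sum.inl b) := by
    intro a b h
    simp only [ladderGraph, fromRel_adj, ladderRel, ne_eq, Sum.inl.injEq, Fin.ext_iff]
    omega
  have hv : ∀ a b : Fin n, (a : ℕ) + 1 = b →
      (ladderGraph m n cross).Adj (Sum.inr a) (Sum.inr b) := by
    intro a b h
    simp only [ladderGraph, fromRel_adj, ladderRel, ne_eq, Sum.inr.injEq, Fin.ext_iff]
    omega
  have hadj : ∀ d ∈ cross, (ladderGraph m n cross).Adj (Sum.inl d.1) (Sum.inr d.2) := by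
    intro d hd
    simp [ladderGraph, ladderRel, hd]
  refine fun h => h.2 ?_
  rcases ha with ⟨f, hf⟩ | ⟨f, hf⟩ <;> rcases hb with ⟨g, hg⟩ | ⟨g, hg⟩ <;>
    simp only [Lup, Ldown, Rup, Rdown, Finset.mem_inter, Finset.mem_filter] at hf hg <;>
    obtain ⟨⟨hfc, hf₁⟩, -, hf₂⟩ := hf <;> obtain ⟨⟨hgc, hg₁⟩, -, hg₂⟩ := hg
  · exact containsSubdivision_of_lt huv hu hv (hadj e he) (hadj f hfc) (hadj g hgc)
      hf₁ hg₁ hg₂ hf₂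
  · exact containsSubdivision_of_lt hvu hv hu (hadj e he).symm (hadj f hfc).symm
      (hadj g hgc).symm hf₂ hg₂ hg₁ hf₁
  · exact containsSubdivision_of_gt hvu hv hu (hadj e he).symm (hadj g hgc).symm
      (hadj f hfc).symm hg₂ hf₂ hf₁ hg₁
  · exact containsSubdivision_of_gt huv hu hv (hadj e he) (hadj g hgc) (hadj f hfc)
      hg₁ hf₁ hf₂ hg₂
end

section
/- Let G be a generalized (m,n)-ladder graph. If there exist indices 1 ≤ i < j ≤ m and 1 ≤ r < s ≤ n such that all four edges u_i v_r, u_i v_s, u_j v_r, u_j v_s belong to [G₁,G₂], then G contains a subdivision of K₄ (and hence G is not outerplanar). -/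
open SimpleGraph

/-- To find a subdivision of `H` in `G` it suffices to give branch vertices, a set of admissible
inner vertices for every edge of `H`, and walks through these sets. -/
theorem ContainsSubdivision.of_walks {V W : Type*} {G : SimpleGraph V} {H : SimpleGraph W}
    (f : W → V) (hf : Function.Injective f) (inner : Sym2 W → Set V)
    (hfi : ∀ w e, f w ∉ inner e)
    (hdisj : ∀ e e' v, v ∈ inner e → v ∈ inner e' → e = e')
    (hwalk : ∀ a b, H.Adj a b → ∃ p : G.Walk (f a) (f b),
      ∀ v ∈ p.support, v = f a ∨ v = f b ∨ v ∈ inner s(a, b)) :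
    ContainsSubdivision G H := by
  classical
  choose p hp using hwalk
  have hq : ∀ a b (h : H.Adj a b), ∀ v ∈ (p a b h).bypass.support,
      v = f a ∨ v = f b ∨ v ∈ inner s(a, b) :=
    fun a b h v hv => hp a b h v ((p a b h).support_bypass_subset_support hv)
  refine ⟨f, hf, fun a b h => (p a b h).bypass, fun a b h => (p a b h).bypass_isPath, ?_, ?_⟩
  · intro a b h w hw
    rcases hq a b h _ hw with h' | h' | h'
    · exact Or.inl (hf h')
    · exact Or.inr (hf h')
    · exact absurd h' (hfi _ _)
  · intro a b a' b' h h' hne v hv hv'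
    have h₁ := hq a b h v hv
    have h₂ := hq a' b' h' v hv'
    grind

/-- A map sending consecutive elements of `Fin m` to adjacent vertices yields, for `i ≤ j`, a walk
from the image of `i` to the image of `j` through the images of the elements in between. -/
theorem exists_walk_of_adj_succ {V : Type*} {G : SimpleGraph V} {m : ℕ} (g : Fin m → V)
    (hg : ∀ i j : Fin m, (i : ℕ) + 1 = j → G.Adj (g i) (g j)) (i j : Fin m) (hij : i ≤ j) :
    ∃ p : G.Walk (g i) (g j), ∀ v ∈ p.support, ∃ k, i ≤ k ∧ k ≤ j ∧ v = g k := by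
  obtain ⟨j, hj⟩ := j
  induction j with
  | zero =>
    obtain rfl : i = ⟨0, hj⟩ := Fin.ext (Nat.le_zero.mp hij)
    exact ⟨.nil, fun v hv => ⟨_, le_rfl, le_rfl, by simpa using hv⟩⟩
  | succ j ih =>
    rcases hij.eq_or_lt with rfl | hlt
    · exact ⟨.nil, fun v hv => ⟨_, le_rfl, le_rfl, by simpa using hv⟩⟩
    · obtain ⟨p, hp⟩ := ih (by omega) (Nat.lt_succ_iff.mp hlt)
      refine ⟨p.concat (hg ⟨j, by omega⟩ ⟨j + 1, hj⟩ rfl), fun v hv => ?_⟩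
      rw [Walk.support_concat, List.mem_append, List.mem_singleton] at hv
      rcases hv with hv | rfl
      · obtain ⟨k, hik, hkj, rfl⟩ := hp v hv
        exact ⟨k, hik, hkj.trans (Nat.le_succ j), rfl⟩
      · exact ⟨_, hij, le_rfl, rfl⟩

/-- If there are indices `i < j` on `G₁` and `r < s` on `G₂` such that all four cross edges
`u_i v_r`, `u_i v_s`, `u_j v_r`, `u_j v_s` are present, then the generalized ladder graph
contains a subdivision of `K₄`, and hence it is not outerplanar. -/
theorem ladder_containsSubdivision_K4 (m n : ℕ) (hm : 0 < m) (hn : 0 < n)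
    (cross : Finset (Fin m × Fin n)) (i j : Fin m) (r s : Fin n)
    (hij : i < j) (hrs : r < s)
    (h1 : (i, r) ∈ cross) (h2 : (i, s) ∈ cross)
    (h3 : (j, r) ∈ cross) (h4 : (j, s) ∈ cross) :
    ContainsSubdivision (ladderGraph m n cross) (completeGraph (Fin 4)) ∧
      ¬ IsOuterplanar (ladderGraph m n cross) := by
  have hK : ContainsSubdivision (ladderGraph m n cross) (completeGraph (Fin 4)) := by
    have hcross : ∀ a b, (a, b) ∈ cross →
        (ladderGraph m n cross).Adj (Sum.inl a) (Sum.inr b) := fun a b h => by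
      simp [ladderGraph, ladderRel, h]
    obtain ⟨p, hp⟩ := exists_walk_of_adj_succ (G := ladderGraph m n cross) Sum.inl
      (fun a b h => by simp [ladderGraph, ladderRel, h, Fin.ext_iff]; omega) i j hij.le
    obtain ⟨q, hq⟩ := exists_walk_of_adj_succ (G := ladderGraph m n cross) Sum.inr
      (fun a b h => by simp [ladderGraph, ladderRel, h, Fin.ext_iff]; omega) r s hrs.le
    let f : Fin 4 → Fin m ⊕ Fin n := ![Sum.inl i, Sum.inl j, Sum.inr r, Sum.inr s]
    let inner : Sym2 (Fin 4) → Set (Fin m ⊕ Fin n) := fun e =>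
      {v | (e = s(0, 1) ∧ ∃ k, i < k ∧ k < j ∧ v = Sum.inl k) ∨
        (e = s(2, 3) ∧ ∃ k, r < k ∧ k < s ∧ v = Sum.inr k)}
    have hwalk : ∀ a b, a < b → ∃ p : (ladderGraph m n cross).Walk (f a) (f b),
        ∀ v ∈ p.support, v = f a ∨ v = f b ∨ v ∈ inner s(a, b) := by
      have hedge : ∀ a b, (ladderGraph m n cross).Adj (f a) (f b) →
          ∃ p : (ladderGraph m n cross).Walk (f a) (f b),
            ∀ v ∈ p.support, v = f a ∨ v = f b ∨ v ∈ inner s(a, b) := fun a b h =>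
        ⟨h.toWalk, fun v hv => by
          have hv' : v = f a ∨ v = f b := by simpa using hv
          tauto⟩
      intro a b hab
      fin_cases a <;> fin_cases b <;> try first
        | exact absurd hab (by decide)
        | exact hedge _ _ (hcross _ _ ‹_›)
      · refine ⟨p, fun v hv => ?_⟩
        obtain ⟨k, hik, hkj, rfl⟩ := hp v hv
        rcases hik.eq_or_lt with rfl | hik
        · exact Or.inl rfl
        rcases hkj.eq_or_lt with rfl | hkj
        · exact Or.inr (Or.inl rfl)
        exact Or.inr (Or.inr (Or.inl ⟨rfl, k, hik, hkj, rfl⟩))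
      · refine ⟨q, fun v hv => ?_⟩
        obtain ⟨k, hik, hkj, rfl⟩ := hq v hv
        rcases hik.eq_or_lt with rfl | hik
        · exact Or.inl rfl
        rcases hkj.eq_or_lt with rfl | hkj
        · exact Or.inr (Or.inl rfl)
        exact Or.inr (Or.inr (Or.inr ⟨rfl, k, hik, hkj, rfl⟩))
    refine .of_walks f ?_ inner ?_ ?_ ?_
    · intro a b hab
      fin_cases a <;> fin_cases b <;> try first
        | rfl
        | exact absurd hab (by simp [f, hij.ne, hij.ne', hrs.ne, hrs.ne'])
    · rintro w e (⟨-, k, hk, hk', h⟩ | ⟨-, k, hk, hk', h⟩) <;> fin_cases w <;> simp [f] at h <;>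
        subst h <;> simp at hk hk'
    · rintro e e' v (⟨rfl, k, -, -, rfl⟩ | ⟨rfl, k, -, -, rfl⟩)
        (⟨rfl, k', -, -, h⟩ | ⟨rfl, k', -, -, h⟩) <;> first | rfl | cases h
    · intro a b hab
      rcases lt_or_gt_of_ne hab.ne with h | h
      · exact hwalk a b h
      · obtain ⟨p, hp⟩ := hwalk b a h
        refine ⟨p.reverse, fun v hv => ?_⟩
        rw [Walk.support_reverse, List.mem_reverse] at hv
        rw [Sym2.eq_swap]
        have := hp v hv
        tauto
  exact ⟨hK, fun h => h.1 hK⟩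
end

section
/- Let G be a generalized (m,n)-ladder graph. If there exist edges e, f ∈ [G₁,G₂] (not necessarily distinct) such that (L↑(e) ∩ R↑(e) ≠ ∅ or L↓(e) ∩ R↓(e) ≠ ∅) and (L↑(f) ∩ R↓(f) ≠ ∅ or L↓(f) ∩ R↑(f) ≠ ∅), then G is not outerplanar. -/
open SimpleGraph

/-- A family of walks supported in prescribed sets, one for each edge of `H` in some orientation
`r`, gives a subdivision of `H` as soon as the sets meet only in common branch vertices. -/
theorem ContainsSubdivision.of_oriented {V W : Type*} {G : SimpleGraph V} {H : SimpleGraph W}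
    (r : W → W → Prop) (hr : ∀ a b, H.Adj a b → r a b ∨ r b a)
    (f : W → V) (hf : Function.Injective f) (S : W → W → Set V)
    (hwalk : ∀ a b, r a b → ∃ p : G.Walk (f a) (f b), ∀ v ∈ p.support, v ∈ S a b)
    (hbranch : ∀ a b w, r a b → f w ∈ S a b → w = a ∨ w = b)
    (hdisj : ∀ a b a' b', r a b → r a' b' → ¬ (a = a' ∧ b = b') →
      ∀ v, v ∈ S a b → v ∈ S a' b' → v = f a ∨ v = f b) :
    ContainsSubdivision G H := by
  classical
  have key : ∀ a b, H.Adj a b → ∃ p : G.Walk (f a) (f b), p.IsPath ∧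
      ((r a b ∧ ∀ v ∈ p.support, v ∈ S a b) ∨ (r b a ∧ ∀ v ∈ p.support, v ∈ S b a)) := by
    intro a b h
    rcases hr a b h with h | h
    · obtain ⟨p, hp⟩ := hwalk a b h
      exact ⟨p.bypass, p.bypass_isPath,
        .inl ⟨h, fun v hv => hp v (p.support_bypass_subset_support hv)⟩⟩
    · obtain ⟨p, hp⟩ := hwalk b a h
      refine ⟨p.reverse.bypass, p.reverse.bypass_isPath, .inr ⟨h, fun v hv => hp v ?_⟩⟩
      simpa using p.reverse.support_bypass_subset_support hv
  choose p hp hS using key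
  refine ⟨f, hf, fun a b h => p a b h, fun a b h => hp a b h, ?_, ?_⟩
  · intro a b h w hw
    rcases hS a b h with ⟨h1, h2⟩ | ⟨h1, h2⟩
    · exact hbranch a b w h1 (h2 _ hw)
    · exact (hbranch b a w h1 (h2 _ hw)).symm
  · intro a b a' b' h h' hne v hv hv'
    have hne1 : ¬ (a = a' ∧ b = b') := by rintro ⟨rfl, rfl⟩; exact hne rfl
    have hne2 : ¬ (a = b' ∧ b = a') := by rintro ⟨rfl, rfl⟩; exact hne Sym2.eq_swap
    rcases hS a b h with ⟨h1, h2⟩ | ⟨h1, h2⟩ <;> rcases hS a' b' h' with ⟨h3, h4⟩ | ⟨h3, h4⟩ <;>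
    · have A := hdisj _ _ _ _ h1 h3 (by tauto) v (h2 v hv) (h4 v hv')
      have B := hdisj _ _ _ _ h3 h1 (by tauto) v (h4 v hv') (h2 v hv)
      tauto

/-- `u` lists vertices of `G` without repetition so that any two of them are joined by a walk
through listed vertices lying between them. -/
def IsLinearlyTraced {V α : Type*} [LinearOrder α] (G : SimpleGraph V) (u : α → V) : Prop :=
  Function.Injective u ∧
    ∀ i j, i ≤ j → ∃ p : G.Walk (u i) (u j), ∀ v ∈ p.support, ∃ k, i ≤ k ∧ k ≤ j ∧ v = u k

theorem IsLinearlyTraced.dual {V α : Type*} [LinearOrder α] {G : SimpleGraph V} {u : α → V}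
    (h : IsLinearlyTraced G u) : IsLinearlyTraced G (u ∘ OrderDual.ofDual : αᵒᵈ → V) := by
  refine ⟨h.1.comp OrderDual.ofDual.injective, fun i j hij => ?_⟩
  obtain ⟨p, hp⟩ := h.2 (OrderDual.ofDual j) (OrderDual.ofDual i) hij
  refine ⟨p.reverse, fun v hv => ?_⟩
  obtain ⟨k, hk, hk', rfl⟩ := hp v (by simpa using hv)
  exact ⟨OrderDual.toDual k, hk', hk, rfl⟩

section Configurations

variable {V α β : Type*} [LinearOrder α] [LinearOrder β] {G : SimpleGraph V}
  {u : α → V} {w : β → V}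

set_option maxHeartbeats 1000000 in
theorem containsSubdivision_completeBipartiteGraph_of_fork
    (hu : IsLinearlyTraced G u) (hw : IsLinearlyTraced G w) (huw : ∀ i j, u i ≠ w j)
    {a c p : α} {b d q : β} (hac : a < c) (hap : a < p) (hqb : q < b) (hbd : b < d)
    (hab : G.Adj (u a) (w b)) (hcd : G.Adj (u c) (w d)) (hpq : G.Adj (u p) (w q)) :
    ContainsSubdivision G (completeBipartiteGraph (Fin 3) (Fin 2)) := by
  have hui : ∀ i j, u i = u j ↔ i = j := fun _ _ => hu.1.eq_iff
  have hwi : ∀ i j, w i = w j ↔ i = j := fun _ _ => hw.1.eq_iff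
  obtain ⟨h, hah, hhc, hhp, hh⟩ : ∃ h, a < h ∧ h ≤ c ∧ h ≤ p ∧ (h = c ∨ h = p) :=
    ⟨min c p, lt_min hac hap, min_le_left _ _, min_le_right _ _, by grind⟩
  let f : Fin 3 ⊕ Fin 2 → V := Sum.elim ![u a, w d, w q] ![u h, w b]
  let S : Fin 3 → Fin 2 → Set V :=
    ![![{v | ∃ k, a ≤ k ∧ k ≤ h ∧ v = u k}, {v | v = u a ∨ v = w b}],
      ![{v | v = w d ∨ ∃ k, h ≤ k ∧ k ≤ c ∧ v = u k}, {v | ∃ k, b ≤ k ∧ k ≤ d ∧ v = w k}],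
      ![{v | v = w q ∨ ∃ k, h ≤ k ∧ k ≤ p ∧ v = u k}, {v | ∃ k, q ≤ k ∧ k ≤ b ∧ v = w k}]]
  refine ContainsSubdivision.of_oriented (fun x y => ∃ i j, x = .inl i ∧ y = .inr j) ?_ f ?_
    (fun x y => {v | ∃ i j, x = .inl i ∧ y = .inr j ∧ v ∈ S i j}) ?_ ?_ ?_
  · rintro (i | i) (j | j) <;> simp
  · rintro (i | i) (j | j) <;> fin_cases i <;> fin_cases j <;> simp [f] <;> grind
  · have spoke : ∀ {k : α} {l : β}, h ≤ k → G.Adj (u k) (w l) →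
        ∃ t : G.Walk (w l) (u h), ∀ v ∈ t.support, v = w l ∨ ∃ i, h ≤ i ∧ i ≤ k ∧ v = u i := by
      intro k l hk hkl
      obtain ⟨t, ht⟩ := hu.2 h k hk
      exact ⟨.cons hkl.symm t.reverse, fun v hv =>
        (by simpa using hv : v = w l ∨ v ∈ t.support).imp id (ht v)⟩
    have edge : ∃ t : G.Walk (u a) (w b), ∀ v ∈ t.support, v = u a ∨ v = w b :=
      ⟨hab.toWalk, by simp⟩
    have down : ∃ t : G.Walk (w d) (w b), ∀ v ∈ t.support, ∃ k, b ≤ k ∧ k ≤ d ∧ v = w k := by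
      obtain ⟨t, ht⟩ := hw.2 b d hbd.le
      exact ⟨t.reverse, fun v hv => ht v (by simpa using hv)⟩
    rintro _ _ ⟨i, j, rfl, rfl⟩
    suffices ∃ p : G.Walk (f (.inl i)) (f (.inr j)), ∀ v ∈ p.support, v ∈ S i j by
      obtain ⟨p, hp⟩ := this
      exact ⟨p, fun v hv => ⟨i, j, rfl, rfl, hp v hv⟩⟩
    fin_cases i <;> fin_cases j
    · exact hu.2 a h hah.le
    · exact edge
    · exact spoke hhc hcd
    · exact down
    · exact spoke hhp hpq
    · exact hw.2 q b hqb.le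
  · rintro _ _ x ⟨i, j, rfl, rfl⟩ ⟨_, _, ⟨⟩, ⟨⟩, hx⟩
    rcases x with k | k <;> fin_cases i <;> fin_cases j <;> fin_cases k <;>
      simp [f, S] at hx ⊢ <;> grind
  · rintro _ _ _ _ ⟨i, j, rfl, rfl⟩ ⟨i', j', rfl, rfl⟩ hne v ⟨_, _, ⟨⟩, ⟨⟩, hv⟩
      ⟨_, _, ⟨⟩, ⟨⟩, hv'⟩
    fin_cases i <;> fin_cases j <;> fin_cases i' <;> fin_cases j' <;>
      simp [f, S] at hne hv hv' ⊢ <;> grind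

theorem containsSubdivision_completeGraph_of_square
    (hu : IsLinearlyTraced G u) (hw : IsLinearlyTraced G w) (huw : ∀ i j, u i ≠ w j)
    {a c : α} {b d : β} (hac : a < c) (hbd : b < d)
    (hab : G.Adj (u a) (w b)) (had : G.Adj (u a) (w d))
    (hcb : G.Adj (u c) (w b)) (hcd : G.Adj (u c) (w d)) :
    ContainsSubdivision G (completeGraph (Fin 4)) := by
  have hui : ∀ i j, u i = u j ↔ i = j := fun _ _ => hu.1.eq_iff
  have hwi : ∀ i j, w i = w j ↔ i = j := fun _ _ => hw.1.eq_iff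
  let f : Fin 4 → V := ![u a, u c, w b, w d]
  let S : Fin 4 → Fin 4 → Set V := fun i j =>
    if i = 0 ∧ j = 1 then {v | ∃ k, a ≤ k ∧ k ≤ c ∧ v = u k}
    else if i = 2 ∧ j = 3 then {v | ∃ k, b ≤ k ∧ k ≤ d ∧ v = w k}
    else {v | v = f i ∨ v = f j}
  refine ContainsSubdivision.of_oriented (· < ·) (fun i j h => lt_or_gt_of_ne h) f ?_ S ?_ ?_ ?_
  · intro i j
    fin_cases i <;> fin_cases j <;> simp [f] <;> grind
  · intro i j hij
    have edge : ∀ {x y : V}, G.Adj x y → ∃ p : G.Walk x y, ∀ v ∈ p.support, v = x ∨ v = y :=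
      fun h => ⟨h.toWalk, by simp⟩
    fin_cases i <;> fin_cases j <;> first | exact absurd hij (by decide) | skip
    · exact hu.2 a c hac.le
    · exact edge hab
    · exact edge had
    · exact edge hcb
    · exact edge hcd
    · exact hw.2 b d hbd.le
  · intro i j k hij hk
    fin_cases i <;> fin_cases j <;> first
      | exact absurd hij (by decide)
      | fin_cases k <;> simp [f, S] at hk ⊢ <;> grind
  · intro i j i' j' hij hij' hne v hv hv'
    fin_cases i <;> fin_cases j <;> first
      | exact absurd hij (by decide)
      | fin_cases i' <;> fin_cases j' <;> first
        | exact absurd hij' (by decide)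
        | simp [f, S] at hne hv hv' ⊢ <;> grind

theorem containsSubdivision_completeBipartiteGraph_of_three_edges
    (hu : IsLinearlyTraced G u) (hw : IsLinearlyTraced G w) (huw : ∀ i j, u i ≠ w j)
    {a c p : α} {b d q : β}
    (hab : G.Adj (u a) (w b)) (hcd : G.Adj (u c) (w d)) (hpq : G.Adj (u p) (w q))
    (hinc : a < c ∧ b < d ∨ c < a ∧ d < b) (hdec : a < p ∧ q < b ∨ p < a ∧ b < q) :
    ContainsSubdivision G (completeBipartiteGraph (Fin 3) (Fin 2)) := by
  rcases hinc with ⟨h1, h2⟩ | ⟨h1, h2⟩ <;> rcases hdec with ⟨h3, h4⟩ | ⟨h3, h4⟩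
  · exact containsSubdivision_completeBipartiteGraph_of_fork hu hw huw h1 h3 h4 h2 hab hcd hpq
  · exact containsSubdivision_completeBipartiteGraph_of_fork hw hu (fun i j => (huw j i).symm)
      h2 h4 h3 h1 hab.symm hcd.symm hpq.symm
  · exact containsSubdivision_completeBipartiteGraph_of_fork (α := βᵒᵈ) hw.dual hu
      (fun i j => (huw j i).symm) (a := OrderDual.toDual b) (c := OrderDual.toDual q)
      (p := OrderDual.toDual d) h4 h2 h1 h3 hab.symm hpq.symm hcd.symm
  · exact containsSubdivision_completeBipartiteGraph_of_fork (α := αᵒᵈ) hu.dual hw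
      (fun i j => huw i j) (a := OrderDual.toDual a) (c := OrderDual.toDual p)
      (p := OrderDual.toDual c) h3 h1 h2 h4 hab hpq hcd

end Configurations

theorem isLinearlyTraced_of_adj_succ {V : Type*} {G : SimpleGraph V} {m : ℕ} {u : Fin m → V}
    (hu : Function.Injective u) (hadj : ∀ i j : Fin m, (i : ℕ) + 1 = j → G.Adj (u i) (u j)) :
    IsLinearlyTraced G u := by
  refine ⟨hu, ?_⟩
  rintro i ⟨j, hj⟩ hij
  induction j with
  | zero =>
    obtain rfl : i = ⟨0, hj⟩ := le_antisymm hij (Nat.zero_le _)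
    exact ⟨.nil, fun v hv => ⟨_, le_rfl, le_rfl, by simpa using hv⟩⟩
  | succ j ih =>
    rcases hij.eq_or_lt with rfl | hlt
    · exact ⟨.nil, fun v hv => ⟨_, le_rfl, le_rfl, by simpa using hv⟩⟩
    · obtain ⟨p, hp⟩ := ih (by omega) (Nat.le_of_lt_succ hlt)
      refine ⟨p.concat (hadj ⟨j, by omega⟩ ⟨j + 1, hj⟩ rfl), fun v hv => ?_⟩
      rw [Walk.support_concat, List.mem_append, List.mem_singleton] at hv
      rcases hv with hv | rfl
      · obtain ⟨k, hk, hk', rfl⟩ := hp v hv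
        exact ⟨k, hk, hk'.trans (Nat.le_succ j), rfl⟩
      · exact ⟨_, hij, le_rfl, rfl⟩

/-- If there are cross edges `e`, `f` (not necessarily distinct) with
(`L↑(e) ∩ R↑(e) ≠ ∅` or `L↓(e) ∩ R↓(e) ≠ ∅`) and
(`L↑(f) ∩ R↓(f) ≠ ∅` or `L↓(f) ∩ R↑(f) ≠ ∅`), then the generalized ladder graph is not
outerplanar. -/
theorem ladder_not_outerplanar_of_two_edges (m n : ℕ) (hm : 0 < m) (hn : 0 < n)
    (cross : Finset (Fin m × Fin n)) (e f : Fin m × Fin n)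
    (he : e ∈ cross) (hf : f ∈ cross)
    (h1 : (Lup cross e ∩ Rup cross e).Nonempty ∨ (Ldown cross e ∩ Rdown cross e).Nonempty)
    (h2 : (Lup cross f ∩ Rdown cross f).Nonempty ∨ (Ldown cross f ∩ Rup cross f).Nonempty) :
    ¬ IsOuterplanar (ladderGraph m n cross) := by
  have hu : IsLinearlyTraced (ladderGraph m n cross) Sum.inl :=
    isLinearlyTraced_of_adj_succ Sum.inl_injective fun i j h => by
      simp only [ladderGraph, SimpleGraph.fromRel_adj, ladderRel, ne_eq, Sum.inl.injEq]
      grind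
  have hw : IsLinearlyTraced (ladderGraph m n cross) Sum.inr :=
    isLinearlyTraced_of_adj_succ Sum.inr_injective fun i j h => by
      simp only [ladderGraph, SimpleGraph.fromRel_adj, ladderRel, ne_eq, Sum.inr.injEq]
      grind
  have huw : ∀ (i : Fin m) (j : Fin n), (Sum.inl i : Fin m ⊕ Fin n) ≠ Sum.inr j := by simp
  have hadj : ∀ x ∈ cross, (ladderGraph m n cross).Adj (Sum.inl x.1) (Sum.inr x.2) := by
    intro x hx
    simpa [ladderGraph, ladderRel] using hx
  rintro ⟨hK4, hK32⟩
  have no_triple : ∀ x ∈ cross, ∀ y ∈ cross, ∀ z ∈ cross,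
      (x.1 < y.1 ∧ x.2 < y.2 ∨ y.1 < x.1 ∧ y.2 < x.2) →
      (x.1 < z.1 ∧ z.2 < x.2 ∨ z.1 < x.1 ∧ x.2 < z.2) → False :=
    fun x hx y hy z hz hinc hdec =>
      hK32 (containsSubdivision_completeBipartiteGraph_of_three_edges hu hw huw
        (hadj x hx) (hadj y hy) (hadj z hz) hinc hdec)
  obtain ⟨x, hx, y, hy, hxy⟩ : ∃ x ∈ cross, ∃ y ∈ cross, x.1 < y.1 ∧ x.2 < y.2 := by
    rcases h1 with ⟨g, hg⟩ | ⟨g, hg⟩ <;>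
      simp only [Lup, Rup, Ldown, Rdown, Finset.mem_inter, Finset.mem_filter] at hg
    · exact ⟨e, he, g, hg.1.1, hg.1.2, hg.2.2⟩
    · exact ⟨g, hg.1.1, e, he, hg.1.2, hg.2.2⟩
  obtain ⟨s, hs, t, ht, hst⟩ : ∃ s ∈ cross, ∃ t ∈ cross, s.1 < t.1 ∧ t.2 < s.2 := by
    rcases h2 with ⟨g, hg⟩ | ⟨g, hg⟩ <;>
      simp only [Lup, Rup, Ldown, Rdown, Finset.mem_inter, Finset.mem_filter] at hg
    · exact ⟨f, hf, g, hg.1.1, hg.1.2, hg.2.2⟩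
    · exact ⟨g, hg.1.1, f, hf, hg.1.2, hg.2.2⟩
  -- Each of `s`, `t` shares an endpoint with each of `x`, `y`.
  have tie : ∀ g ∈ ({x, y} : Set (Fin m × Fin n)), ∀ k ∈ ({s, t} : Set (Fin m × Fin n)),
      g.1 = k.1 ∨ g.2 = k.2 := by
    intro g hg k hk
    have hgc : g ∈ cross := by rcases hg with rfl | rfl <;> assumption
    have hkc : k ∈ cross := by rcases hk with rfl | rfl <;> assumption
    by_contra! hne
    rcases lt_or_gt_of_ne hne.1 with h | h <;> rcases lt_or_gt_of_ne hne.2 with h' | h'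
    · rcases hk with rfl | rfl
      · exact no_triple k hkc g hgc t ht (.inr ⟨h, h'⟩) (.inl hst)
      · exact no_triple k hkc g hgc s hs (.inr ⟨h, h'⟩) (.inr hst)
    · rcases hg with rfl | rfl
      · exact no_triple g hgc y hy k hkc (.inl hxy) (.inl ⟨h, h'⟩)
      · exact no_triple g hgc x hx k hkc (.inr hxy) (.inl ⟨h, h'⟩)
    · rcases hg with rfl | rfl
      · exact no_triple g hgc y hy k hkc (.inl hxy) (.inr ⟨h, h'⟩)
      · exact no_triple g hgc x hx k hkc (.inr hxy) (.inr ⟨h, h'⟩)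
    · rcases hk with rfl | rfl
      · exact no_triple k hkc g hgc t ht (.inl ⟨h, h'⟩) (.inl hst)
      · exact no_triple k hkc g hgc s hs (.inl ⟨h, h'⟩) (.inr hst)
  have e1 := tie x (by simp) s (by simp)
  have e2 := tie x (by simp) t (by simp)
  have e3 := tie y (by simp) s (by simp)
  have e4 := tie y (by simp) t (by simp)
  obtain ⟨hs1, hs2, ht1, ht2⟩ : s.1 = x.1 ∧ s.2 = y.2 ∧ t.1 = y.1 ∧ t.2 = x.2 := by
    grind
  have hs' := hadj s hs
  have ht' := hadj t ht
  rw [hs1, hs2] at hs'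
  rw [ht1, ht2] at ht'
  exact hK4 (containsSubdivision_completeGraph_of_square hu hw huw hxy.1 hxy.2
    (hadj x hx) hs' ht' (hadj y hy))
end
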